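/- Let W ∈ ∂θ(P) with P ≠ 0 and Q = P + W. For any D ∈ ℝ^{m×n}, if H ∈ ℝ^{m×n} satisfies H = Prox'_θ(Q; H + D), where Prox'_θ(Q;·) is the directional derivative of the proximal mapping Prox_θ at Q, then H ∈ C_θ(P,W) and ⟨H, D⟩ = −ψ*_{(P,H)}(W). -/

import Mathlib

open Matrix Filter Set RealInnerProductSpace

noncomputable section

/-- Trace inner product on real matrices: `⟨A,B⟩ = trace (Aᵀ B)`. -/
def minner {ι κ : Type*} [Fintype ι] [Fintype κ] (A B : Matrix ι κ ℝ) : ℝ :=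
  (Aᵀ * B).trace

/-- Frobenius norm. -/
def fnorm {ι κ : Type*} [Fintype ι] [Fintype κ] (A : Matrix ι κ ℝ) : ℝ :=
  Real.sqrt (minner A A)

/-- Spectral norm (largest singular value), as the ℓ²-operator norm. -/
def specNorm {ι κ : Type*} [Fintype ι] [Fintype κ] (A : Matrix ι κ ℝ) : ℝ :=
  sSup {r : ℝ | ∃ x : κ → ℝ, ∑ j, x j ^ 2 = 1 ∧
    r = Real.sqrt (∑ i, (∑ j, A i j * x j) ^ 2)}

/-- Convex subdifferential with respect to the trace inner product. -/
def subdiff {ι κ : Type*} [Fintype ι] [Fintype κ] (f : Matrix ι κ ℝ → ℝ)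
    (X : Matrix ι κ ℝ) : Set (Matrix ι κ ℝ) :=
  {G | ∀ Y, f X + minner G (Y - X) ≤ f Y}

/-- One-sided directional derivative. -/
def dirDeriv {ι κ : Type*} [Fintype ι] [Fintype κ] (f : Matrix ι κ ℝ → ℝ)
    (X D : Matrix ι κ ℝ) : ℝ :=
  limUnder (nhdsWithin (0 : ℝ) (Set.Ioi 0)) fun t => (f (X + t • D) - f X) / t

/-- Critical cone of the spectral norm θ at `P` for `W`. -/
def critTheta {ι κ : Type*} [Fintype ι] [Fintype κ] (P W : Matrix ι κ ℝ) :
    Set (Matrix ι κ ℝ) :=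
  {D | dirDeriv specNorm P D = minner D W}

/-- Conjugate θ* of the spectral norm, as an extended-real-valued function
(it is the indicator of the nuclear norm unit ball). -/
def thetaStar {ι κ : Type*} [Fintype ι] [Fintype κ] (W : Matrix ι κ ℝ) : EReal :=
  ⨆ X : Matrix ι κ ℝ, ((minner W X - specNorm X : ℝ) : EReal)

/-- Lower directional epiderivative of an extended-real-valued function. -/
def epiDeriv {ι κ : Type*} [Fintype ι] [Fintype κ] (g : Matrix ι κ ℝ → EReal)
    (X D : Matrix ι κ ℝ) : EReal :=
  liminf (fun p : ℝ × Matrix ι κ ℝ =>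
      (((p.1)⁻¹ : ℝ) : EReal) * (g (X + p.1 • p.2) - g X))
    ((nhdsWithin (0 : ℝ) (Set.Ioi 0)) ×ˢ nhds D)

/-- Critical cone of θ* at `W` for `P`. -/
def critThetaStar {ι κ : Type*} [Fintype ι] [Fintype κ] (W P : Matrix ι κ ℝ) :
    Set (Matrix ι κ ℝ) :=
  {D | epiDeriv thetaStar W D = ((minner D P : ℝ) : EReal)}

/-- Second-order directional derivative. -/
def dirDeriv2 {ι κ : Type*} [Fintype ι] [Fintype κ] (f : Matrix ι κ ℝ → ℝ)
    (X D W' : Matrix ι κ ℝ) : ℝ :=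
  limUnder (nhdsWithin (0 : ℝ) (Set.Ioi 0)) fun t =>
    (f (X + t • D + (t ^ 2 / 2) • W') - f X - t * dirDeriv f X D) / (t ^ 2 / 2)

/-- The sigma term of θ: `ψ*_{(P,D)}(W) = (θ''(P;D,·))*(W)`. -/
def sigmaTheta {ι κ : Type*} [Fintype ι] [Fintype κ] (P D W : Matrix ι κ ℝ) : EReal :=
  ⨆ Z : Matrix ι κ ℝ, ((minner W Z - dirDeriv2 specNorm P D Z : ℝ) : EReal)

/-- Lower second-order directional epiderivative of an EReal-valued function. -/
def epiDeriv2 {ι κ : Type*} [Fintype ι] [Fintype κ] (g : Matrix ι κ ℝ → EReal)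
    (X D W' : Matrix ι κ ℝ) : EReal :=
  liminf (fun p : ℝ × Matrix ι κ ℝ =>
      ((2 / p.1 ^ 2 : ℝ) : EReal) *
        (g (X + p.1 • D + (p.1 ^ 2 / 2) • p.2) - g X - (p.1 : ℝ) * epiDeriv g X D))
    ((nhdsWithin (0 : ℝ) (Set.Ioi 0)) ×ˢ nhds W')

/-- The sigma term of θ*: `φ*_{(W,H)}(P) = ((θ*)''(W;H,·))*(P)`. -/
def sigmaThetaStar {ι κ : Type*} [Fintype ι] [Fintype κ] (W H P : Matrix ι κ ℝ) : EReal :=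
  ⨆ Z : Matrix ι κ ℝ, (((minner P Z : ℝ) : EReal) - epiDeriv2 thetaStar W H Z)

/-- Polar cone with respect to the trace inner product. -/
def polarCone {ι κ : Type*} [Fintype ι] [Fintype κ] (K : Set (Matrix ι κ ℝ)) :
    Set (Matrix ι κ ℝ) :=
  {H | ∀ D ∈ K, minner H D ≤ 0}

/-- Rectangular diagonal matrix `[Diag σ  0]`. -/
def diagRect {m n : ℕ} (σ : Fin m → ℝ) : Matrix (Fin m) (Fin n) ℝ :=
  Matrix.of fun i j => if (j : ℕ) = (i : ℕ) then σ i else 0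

/-- Symmetric part `S(A₁)` of the left m×m block of an m×n matrix. -/
def symLeft {m n : ℕ} (hmn : m ≤ n) (A : Matrix (Fin m) (Fin n) ℝ) :
    Matrix (Fin m) (Fin m) ℝ :=
  Matrix.of fun i j => (A i (Fin.castLE hmn j) + A j (Fin.castLE hmn i)) / 2

/-- Skew-symmetric part `T(A₁)` of the left m×m block of an m×n matrix. -/
def skewLeft {m n : ℕ} (hmn : m ≤ n) (A : Matrix (Fin m) (Fin n) ℝ) :
    Matrix (Fin m) (Fin m) ℝ :=
  Matrix.of fun i j => (A i (Fin.castLE hmn j) - A j (Fin.castLE hmn i)) / 2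

/-- Quadratic form `xᵀ A x`. -/
def quadForm {m : ℕ} (A : Matrix (Fin m) (Fin m) ℝ) (x : Fin m → ℝ) : ℝ :=
  ∑ i, ∑ j, x i * A i j * x j

/-- Proximal mapping. -/
def prox {ι κ : Type*} [Fintype ι] [Fintype κ] (f : Matrix ι κ ℝ → ℝ)
    (Z : Matrix ι κ ℝ) : Matrix ι κ ℝ :=
  Classical.epsilon fun Y =>
    ∀ X, f Y + (1 / 2) * fnorm (Y - Z) ^ 2 ≤ f X + (1 / 2) * fnorm (X - Z) ^ 2

/-- Directional derivative of the proximal mapping. -/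
def proxDeriv {ι κ : Type*} [Fintype ι] [Fintype κ] (f : Matrix ι κ ℝ → ℝ)
    (Z D : Matrix ι κ ℝ) : Matrix ι κ ℝ :=
  limUnder (nhdsWithin (0 : ℝ) (Set.Ioi 0)) fun t =>
    t⁻¹ • (prox f (Z + t • D) - prox f Z)

end

section QuadraticForms

variable {V : Type*} [NormedAddCommGroup V] [InnerProductSpace ℝ V]

/-- `R` is the Moore–Penrose inverse of the symmetric operator `N`. -/
structure IsSymmPinv (N R : V →L[ℝ] V) : Prop where
  symm : ∀ x y, ⟪R x, y⟫ = ⟪x, R y⟫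
  mul_mul_left : ∀ x, N (R (N x)) = N x
  mul_mul_right : ∀ x, R (N (R x)) = R x
  comm : ∀ x, R (N x) = N (R x)

theorem IsSymmPinv.apply_eq_zero {N R : V →L[ℝ] V} (h : IsSymmPinv N R) {x : V} (hx : N x = 0) :
    R x = 0 := by
  rw [← h.mul_mul_right, ← h.comm, hx, map_zero, map_zero]

theorem IsSymmPinv.inner_self_nonneg {N R : V →L[ℝ] V} (h : IsSymmPinv N R)
    (hpos : ∀ x, 0 ≤ ⟪x, N x⟫) (x : V) : 0 ≤ ⟪x, R x⟫ := by
  rw [← h.mul_mul_right, ← h.symm]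
  exact hpos _

theorem exists_isSymmPinv [FiniteDimensional ℝ V] (N : V →L[ℝ] V)
    (hN : ∀ x y, ⟪N x, y⟫ = ⟪x, N y⟫) : ∃ R, IsSymmPinv N R := by
  have hs : (N : V →ₗ[ℝ] V).IsSymmetric := hN
  set b := hs.eigenvectorBasis rfl
  set l := hs.eigenvalues rfl
  have hNb : ∀ i, N (b i) = l i • b i := fun i => hs.apply_eigenvectorBasis rfl i
  set R : V →L[ℝ] V := ∑ i, (l i)⁻¹ • (innerSL ℝ (b i)).smulRight (b i)
  have hR : ∀ x, R x = ∑ i, (l i)⁻¹ • ⟪b i, x⟫ • b i := by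
    intro x
    simp [R]
  have hRb : ∀ i, R (b i) = (l i)⁻¹ • b i := by
    intro i
    rw [hR, Finset.sum_eq_single i]
    · simp
    · intro j _ hj
      simp [b.inner_eq_zero hj]
    · simp
  have ext : ∀ f g : V →L[ℝ] V, (∀ i, f (b i) = g (b i)) → ∀ x, f x = g x := by
    intro f g hfg x
    have : (f : V →ₗ[ℝ] V) = g := b.toBasis.ext fun i => by simpa using hfg i
    exact congrArg (fun h : V →ₗ[ℝ] V => h x) this
  refine ⟨R, ⟨fun x y => ?_, ext (N ∘L R ∘L N) N fun i => ?_, ext (R ∘L N ∘L R) R fun i => ?_,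
    ext (R ∘L N) (N ∘L R) fun i => ?_⟩⟩
  · rw [hR, hR, sum_inner, inner_sum]
    refine Finset.sum_congr rfl fun i _ => ?_
    simp only [real_inner_smul_left, real_inner_smul_right, real_inner_comm x (b i)]
    ring
  · simp only [ContinuousLinearMap.comp_apply, hNb, map_smul, hRb, smul_smul]
    by_cases h : l i = 0 <;> simp [h]
  · simp only [ContinuousLinearMap.comp_apply, hNb, map_smul, hRb, smul_smul]
    by_cases h : l i = 0 <;> simp [h]
  · simp only [ContinuousLinearMap.comp_apply, hNb, map_smul, hRb, smul_smul]
    rw [mul_comm]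

theorem apply_eq_zero_of_inner_self_eq_zero {N : V →L[ℝ] V}
    (hN : ∀ x y, ⟪N x, y⟫ = ⟪x, N y⟫) (hpos : ∀ x, 0 ≤ ⟪x, N x⟫) {x : V}
    (hx : ⟪x, N x⟫ = 0) : N x = 0 := by
  by_contra hne
  have hp : 0 < ⟪N x, N x⟫ := real_inner_self_pos.2 hne
  have key : ∀ s : ℝ, 0 ≤ 2 * s * ⟪N x, N x⟫ + s ^ 2 * ⟪N x, N (N x)⟫ := by
    intro s
    have h := hpos (x + s • N x)
    simp only [map_add, map_smul, inner_add_left, inner_add_right, real_inner_smul_left,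
      real_inner_smul_right, hx, ← hN x (N x)] at h
    nlinarith
  set p := ⟪N x, N x⟫
  set q := ⟪N x, N (N x)⟫
  have hq : 0 ≤ q := hpos _
  have h := key (-(p / (q + 1)))
  have h2 : 2 * -(p / (q + 1)) * p + (-(p / (q + 1))) ^ 2 * q
      = - (p ^ 2 * (q + 2)) / (q + 1) ^ 2 := by
    field_simp
    ring
  rw [h2, div_nonneg_iff] at h
  rcases h with h | h
  · nlinarith [mul_pos (pow_pos hp 2) (by linarith : 0 < q + 2)]
  · nlinarith

/-- Finsler-type lemma: a form that is negative on the zeros of a nonnegative form is dominated by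
a multiple of the latter. -/
theorem exists_le_mul_sub_of_neg_on_zeros [FiniteDimensional ℝ V] (U : Submodule ℝ V)
    {a b : V → ℝ} (ha : Continuous a) (hb : Continuous b)
    (has : ∀ (s : ℝ) x, a (s • x) = s ^ 2 * a x) (hbs : ∀ (s : ℝ) x, b (s • x) = s ^ 2 * b x)
    (ha0 : ∀ x ∈ U, 0 ≤ a x) (hneg : ∀ x ∈ U, x ≠ 0 → a x = 0 → b x < 0) :
    ∃ C δ : ℝ, 0 ≤ C ∧ 0 < δ ∧ ∀ x ∈ U, b x ≤ C * a x - δ * ‖x‖ ^ 2 := by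
  have hK : IsCompact (Metric.sphere (0 : V) 1 ∩ U) :=
    (isCompact_sphere _ _).inter_right U.closed_of_finiteDimensional
  have main : ∃ C δ : ℝ, 0 ≤ C ∧ 0 < δ ∧ ∀ x ∈ Metric.sphere (0 : V) 1 ∩ U,
      x ∈ U → b x ≤ C * a x - δ := by
    refine hK.induction_on (p := fun s => ∃ C δ : ℝ, 0 ≤ C ∧ 0 < δ ∧ ∀ x ∈ s, x ∈ U →
      b x ≤ C * a x - δ) ⟨0, 1, le_rfl, one_pos, by simp⟩ ?_ ?_ ?_
    · rintro s t hst ⟨C, δ, hC, hδ, h⟩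
      exact ⟨C, δ, hC, hδ, fun x hx => h x (hst hx)⟩
    · rintro s t ⟨C, δ, hC, hδ, h⟩ ⟨C', δ', hC', hδ', h'⟩
      refine ⟨max C C', min δ δ', le_max_of_le_left hC, lt_min hδ hδ', ?_⟩
      rintro x (hx | hx) hU
      · have := mul_le_mul_of_nonneg_right (le_max_left C C') (ha0 x hU)
        linarith [h x hx hU, min_le_left δ δ']
      · have := mul_le_mul_of_nonneg_right (le_max_right C C') (ha0 x hU)
        linarith [h' x hx hU, min_le_right δ δ']
    · rintro x ⟨hx, hU⟩
      have hx0 : x ≠ 0 := by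
        rintro rfl
        simp at hx
      obtain ⟨C, hC, hlt⟩ : ∃ C : ℝ, 0 ≤ C ∧ b x - C * a x < 0 := by
        rcases (ha0 x hU).eq_or_lt with h | h
        · exact ⟨0, le_rfl, by simpa using hneg x hU hx0 h.symm⟩
        · refine ⟨(|b x| + 1) / a x, by positivity, ?_⟩
          rw [div_mul_cancel₀ _ h.ne']
          linarith [le_abs_self (b x)]
      have hcont : Continuous fun y => b y - C * a y := hb.sub (continuous_const.mul ha)
      refine ⟨{y | b y - C * a y < (b x - C * a x) / 2}, mem_nhdsWithin_of_mem_nhds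
        ((isOpen_lt hcont continuous_const).mem_nhds ?_), C, -(b x - C * a x) / 2, hC,
        by linarith, ?_⟩
      · show b x - C * a x < (b x - C * a x) / 2
        linarith
      · intro y hy _
        have : b y - C * a y < (b x - C * a x) / 2 := hy
        linarith
  obtain ⟨C, δ, hC, hδ, h⟩ := main
  refine ⟨C, δ, hC, hδ, fun x hx => ?_⟩
  rcases eq_or_ne x 0 with rfl | hx0
  · have h1 := has 0 0
    have h2 := hbs 0 0
    simp at h1 h2
    simp [h1, h2]
  · have hn : 0 < ‖x‖ := norm_pos_iff.2 hx0
    have hmem : ‖x‖⁻¹ • x ∈ U := U.smul_mem _ hx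
    have := h (‖x‖⁻¹ • x) ⟨by simp [norm_smul, hn.ne'], hmem⟩ hmem
    rw [has, hbs] at this
    have h3 := mul_le_mul_of_nonneg_left this (sq_nonneg ‖x‖)
    have e1 : ‖x‖ ^ 2 * (‖x‖⁻¹ ^ 2 * b x) = b x := by field_simp
    have e2 : ‖x‖ ^ 2 * (C * (‖x‖⁻¹ ^ 2 * a x) - δ) = C * a x - δ * ‖x‖ ^ 2 := by field_simp
    linarith

theorem abs_inner_apply_le (A : V →L[ℝ] V) (x y : V) : |⟪x, A y⟫| ≤ ‖A‖ * (‖x‖ * ‖y‖) :=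
  (abs_real_inner_le_norm _ _).trans <| by
    nlinarith [mul_le_mul_of_nonneg_left (A.le_opNorm y) (norm_nonneg x)]

set_option maxHeartbeats 1000000 in
/-- Second-order perturbation: if `A ≤ 0` on `ker N` and the second-order term is negative on the
vectors of `ker N` where `A` vanishes, then `-N + t A + (t² / 2) B ≤ 0` for small `t > 0`. -/
theorem eventually_quadratic_perturbation_nonpos [FiniteDimensional ℝ V] {N R : V →L[ℝ] V}
    (hN : ∀ x y, ⟪N x, y⟫ = ⟪x, N y⟫) (hpos : ∀ x, 0 ≤ ⟪x, N x⟫) (hR : IsSymmPinv N R)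
    {A B : V →L[ℝ] V} (hAs : ∀ x y, ⟪A x, y⟫ = ⟪x, A y⟫) (hBs : ∀ x y, ⟪B x, y⟫ = ⟪x, B y⟫)
    (hA : ∀ e, N e = 0 → ⟪e, A e⟫ ≤ 0)
    (hB : ∀ e, N e = 0 → e ≠ 0 → ⟪e, A e⟫ = 0 → ⟪e, B e⟫ + 2 * ⟪A e, R (A e)⟫ < 0) :
    ∀ᶠ t in nhdsWithin (0 : ℝ) (Ioi 0), ∀ y,
      -⟪y, N y⟫ + t * ⟪y, A y⟫ + t ^ 2 / 2 * ⟪y, B y⟫ ≤ 0 := by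
  obtain ⟨C, δ, hC, hδ, hT⟩ := exists_le_mul_sub_of_neg_on_zeros (LinearMap.ker (N : V →ₗ[ℝ] V))
    (a := fun e => -⟪e, A e⟫) (b := fun e => ⟪e, B e⟫ + 2 * ⟪A e, R (A e)⟫)
    (by fun_prop) (by fun_prop)
    (fun s x => by simp only [map_smul, real_inner_smul_left, real_inner_smul_right]; ring)
    (fun s x => by simp only [map_smul, real_inner_smul_left, real_inner_smul_right]; ring)
    (fun x hx => by linarith [hA x (by simpa using hx)])
    (fun x hx hx0 h => hB x (by simpa using hx) hx0 (by linarith))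
  obtain ⟨c, δ', hc, hδ', hgap⟩ := exists_le_mul_sub_of_neg_on_zeros
    (LinearMap.ker ((R ∘L N - ContinuousLinearMap.id ℝ V : V →L[ℝ] V) : V →ₗ[ℝ] V))
    (a := fun e => ⟪e, N e⟫) (b := fun e => ⟪e, e⟫)
    (by fun_prop) (by fun_prop)
    (fun s x => by simp only [map_smul, real_inner_smul_left, real_inner_smul_right]; ring)
    (fun s x => by simp only [real_inner_smul_left, real_inner_smul_right]; ring)
    (fun x _ => hpos x)
    (fun x hx hx0 h => by
      have h1 : R (N x) - x = 0 := by simpa using hx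
      rw [apply_eq_zero_of_inner_self_eq_zero hN hpos h, map_zero, zero_sub, neg_eq_zero] at h1
      exact absurd h1 hx0)
  set α := ‖A‖
  set β := ‖B‖
  set r := ‖R‖
  have hα : 0 ≤ α := norm_nonneg _
  have hβ : 0 ≤ β := norm_nonneg _
  have hr : 0 ≤ r := norm_nonneg _
  set γ := (α + β) * c
  have hγ : 0 ≤ γ := by positivity
  have hlim : ∀ k : ℝ, ∀ ε > 0, ∀ᶠ t in nhdsWithin (0 : ℝ) (Ioi 0), k * t < ε := by
    intro k ε hε
    have : Tendsto (fun t : ℝ => k * t) (nhdsWithin 0 (Ioi 0)) (nhds 0) := by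
      have : Tendsto (fun t : ℝ => k * t) (nhds 0) (nhds (k * 0)) :=
        (continuous_const.mul continuous_id).tendsto 0
      rw [mul_zero] at this
      exact this.mono_left nhdsWithin_le_nhds
    exact this.eventually_lt_const hε
  filter_upwards [self_mem_nhdsWithin, hlim 1 1 one_pos, hlim γ (1 / 2) (by norm_num),
    hlim C 2 (by norm_num), hlim (2 * γ * (r * α ^ 2) + β / 2) (δ / 2) (by linarith)]
    with t ht0 ht1 htγ htC htδ y
  have ht0 : 0 < t := ht0
  set f := R (N y)
  set e := y - f
  have hy : y = e + f := by simp [e]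
  have hNe : N e = 0 := by simp [e, f, hR.mul_mul_left]
  have hRf : R (N f) = f := by simp [f, hR.mul_mul_left]
  have hTe := hT e (by simpa using hNe)
  have hge := hgap f (by simp [hRf])
  have hAe := hA e hNe
  set n := ⟪f, N f⟫ with hn
  set ρr := ⟪A e, R (A e)⟫ with hρr
  have hn0 : 0 ≤ n := hpos f
  have hρ0 : 0 ≤ ρr := hR.inner_self_nonneg hpos _
  have hρle : ρr ≤ r * α ^ 2 * ‖e‖ ^ 2 := by
    have h1 := (le_abs_self _).trans (abs_inner_apply_le R (A e) (A e))
    have h2 : ‖A e‖ ≤ α * ‖e‖ := A.le_opNorm e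
    have h3 : ‖A e‖ * ‖A e‖ ≤ (α * ‖e‖) * (α * ‖e‖) :=
      mul_le_mul h2 h2 (norm_nonneg _) (by positivity)
    calc ρr ≤ r * (‖A e‖ * ‖A e‖) := h1
      _ ≤ r * ((α * ‖e‖) * (α * ‖e‖)) := mul_le_mul_of_nonneg_left h3 hr
      _ = _ := by ring
  have hff : ‖f‖ ^ 2 ≤ c * n := by
    rw [← real_inner_self_eq_norm_sq]
    have : 0 ≤ δ' * ‖f‖ ^ 2 := by positivity
    linarith
  have e1 : ⟪y, N y⟫ = n := by
    rw [hy, map_add, hNe, zero_add, inner_add_left, ← hN e, hNe, inner_zero_left, zero_add]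
  have e2 : ⟪y, A y⟫ = ⟪e, A e⟫ + 2 * ⟪f, A e⟫ + ⟪f, A f⟫ := by
    rw [hy]
    simp only [map_add, inner_add_left, inner_add_right]
    rw [← hAs e f, real_inner_comm f (A e)]
    ring
  have e3 : ⟪y, B y⟫ = ⟪e, B e⟫ + 2 * ⟪f, B e⟫ + ⟪f, B f⟫ := by
    rw [hy]
    simp only [map_add, inner_add_left, inner_add_right]
    rw [← hBs e f, real_inner_comm f (B e)]
    ring
  have b1 := (le_abs_self _).trans (abs_inner_apply_le A f f)
  have b2 := (le_abs_self _).trans (abs_inner_apply_le B f e)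
  have b3 := (le_abs_self _).trans (abs_inner_apply_le B f f)
  have hsq : 0 ≤ (1 - γ * t) ^ 2 * n - 2 * (1 - γ * t) * t * ⟪f, A e⟫ + t ^ 2 * ρr := by
    have h := hpos ((1 - γ * t) • f - t • R (A e))
    have h1 : ⟪f, N (R (A e))⟫ = ⟪f, A e⟫ := by rw [← hR.comm, ← hR.symm, ← hN, ← hR.comm, hRf]
    have h2 : ⟪R (A e), N f⟫ = ⟪f, A e⟫ := by rw [hR.symm, hRf, real_inner_comm]
    have h3 : ⟪R (A e), N (R (A e))⟫ = ρr := by rw [hR.symm, hR.mul_mul_right]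
    simp only [map_sub, map_smul, inner_sub_left, inner_sub_right, real_inner_smul_left,
      real_inner_smul_right, h1, h2, h3, ← hn] at h
    linarith
  have hρpos : 1 / 2 < 1 - γ * t := by linarith
  have hsq' : 2 * t * ⟪f, A e⟫ - (1 - γ * t) * n ≤ t ^ 2 * ρr * (1 + 2 * γ * t) := by
    have h1 : (1 - γ * t) * (2 * t * ⟪f, A e⟫ - (1 - γ * t) * n) ≤ t ^ 2 * ρr := by linarith
    have h2 : 1 ≤ (1 - γ * t) * (1 + 2 * γ * t) := by
      nlinarith [mul_nonneg hγ ht0.le]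
    have h3 : t ^ 2 * ρr ≤ (1 - γ * t) * (t ^ 2 * ρr * (1 + 2 * γ * t)) := by
      have : 0 ≤ t ^ 2 * ρr := by positivity
      nlinarith
    exact le_of_mul_le_mul_left (h1.trans h3) (by linarith)
  have hrem : t * ⟪f, A f⟫ + t ^ 2 / 2 * (2 * ⟪f, B e⟫ + ⟪f, B f⟫)
      ≤ γ * t * n + t ^ 3 * (β / 2) * ‖e‖ ^ 2 := by
    have h1 : t * ⟪f, A f⟫ ≤ t * (α * ‖f‖ ^ 2) := by
      rw [pow_two]; exact mul_le_mul_of_nonneg_left b1 ht0.le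
    have h2 : t ^ 2 * ⟪f, B e⟫ ≤ t ^ 2 * (β * (‖f‖ * ‖e‖)) :=
      mul_le_mul_of_nonneg_left b2 (by positivity)
    have h3 : t ^ 2 / 2 * ⟪f, B f⟫ ≤ t ^ 2 / 2 * (β * ‖f‖ ^ 2) := by
      rw [pow_two ‖f‖]; exact mul_le_mul_of_nonneg_left b3 (by positivity)
    have h4 : t ^ 2 * (β * (‖f‖ * ‖e‖)) ≤ t * β / 2 * (‖f‖ ^ 2 + t ^ 2 * ‖e‖ ^ 2) := by
      have : 0 ≤ t * β / 2 * (‖f‖ - t * ‖e‖) ^ 2 := by positivity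
      linarith
    have h5 : t ^ 2 / 2 * (β * ‖f‖ ^ 2) ≤ t / 2 * (β * ‖f‖ ^ 2) := by
      have : t ^ 2 ≤ t := by nlinarith
      exact mul_le_mul_of_nonneg_right (by linarith) (by positivity)
    have h6 : t * (α + β) * ‖f‖ ^ 2 ≤ t * (α + β) * (c * n) :=
      mul_le_mul_of_nonneg_left hff (by positivity)
    have h7 : γ * t * n = t * (α + β) * (c * n) := by simp only [γ]; ring
    linarith
  have hfin : t ^ 2 * ρr * (2 * γ * t) ≤ t ^ 3 * (2 * γ * (r * α ^ 2)) * ‖e‖ ^ 2 := by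
    have := mul_le_mul_of_nonneg_left hρle (by positivity : 0 ≤ t ^ 3 * (2 * γ))
    linarith
  have hT2 := mul_le_mul_of_nonneg_left hTe (by positivity : 0 ≤ t ^ 2 / 2)
  have hl1 : ⟪e, A e⟫ * (t * (1 - C * t / 2)) ≤ 0 :=
    mul_nonpos_of_nonpos_of_nonneg hAe (mul_nonneg ht0.le (by linarith))
  have hl2 : t ^ 2 * ‖e‖ ^ 2 * ((2 * γ * (r * α ^ 2) + β / 2) * t - δ / 2) ≤ 0 :=
    mul_nonpos_of_nonneg_of_nonpos (by positivity) (by linarith)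
  rw [e1, e2, e3]
  linarith

/-- The second-order test vector `u + t R A u` for `u ∈ ker N`. -/
theorem inner_test_vector {N R : V →L[ℝ] V} (hN : ∀ x y, ⟪N x, y⟫ = ⟪x, N y⟫)
    (hR : IsSymmPinv N R) {A : V →L[ℝ] V} (hA : ∀ x y, ⟪A x, y⟫ = ⟪x, A y⟫) {u : V}
    (hu : N u = 0) (t : ℝ) :
    -⟪u + t • R (A u), N (u + t • R (A u))⟫ + t * ⟪u + t • R (A u), A (u + t • R (A u))⟫
      = t * ⟪u, A u⟫ + t ^ 2 * ⟪A u, R (A u)⟫ + t ^ 3 * ⟪R (A u), A (R (A u))⟫ := by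
  have h1 : ⟪u, N (R (A u))⟫ = 0 := by rw [← hN, hu, inner_zero_left]
  have h2 : ⟪R (A u), N (R (A u))⟫ = ⟪A u, R (A u)⟫ := by rw [hR.symm, hR.mul_mul_right]
  have h3 : ⟪u, A (R (A u))⟫ = ⟪A u, R (A u)⟫ := by rw [← hA]
  have h4 : ⟪R (A u), A u⟫ = ⟪A u, R (A u)⟫ := real_inner_comm _ _
  simp only [map_add, map_smul, inner_add_left, inner_add_right, real_inner_smul_left,
    real_inner_smul_right, h1, h2, h3, h4, hu, inner_zero_right]
  ring

theorem norm_sq_test_vector {N R : V →L[ℝ] V} (hR : IsSymmPinv N R) {u : V}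
    (hu : N u = 0) (w : V) (t : ℝ) :
    ‖u + t • R w‖ ^ 2 = ‖u‖ ^ 2 + t ^ 2 * ‖R w‖ ^ 2 := by
  have h1 : ⟪u, R w⟫ = 0 := by rw [← hR.symm, hR.apply_eq_zero hu, inner_zero_left]
  rw [norm_add_sq_real, real_inner_smul_right, h1, norm_smul, mul_pow, Real.norm_eq_abs, sq_abs]
  ring

end QuadraticForms

section SpectralNorm

variable {ι κ : Type*} [Fintype ι] [Fintype κ]

theorem minner_eq_sum (A B : Matrix ι κ ℝ) : minner A B = ∑ i, ∑ j, A i j * B i j := by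
  simp only [minner, Matrix.trace, Matrix.diag, Matrix.mul_apply, Matrix.transpose_apply]
  exact Finset.sum_comm

theorem minner_comm (A B : Matrix ι κ ℝ) : minner A B = minner B A := by
  simp only [minner_eq_sum, mul_comm]

theorem minner_add_right (A B C : Matrix ι κ ℝ) : minner A (B + C) = minner A B + minner A C := by
  simp [minner, Matrix.mul_add]

theorem minner_sub_right (A B C : Matrix ι κ ℝ) : minner A (B - C) = minner A B - minner A C := by
  simp [minner, Matrix.mul_sub]

theorem minner_smul_right (s : ℝ) (A B : Matrix ι κ ℝ) : minner A (s • B) = s * minner A B := by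
  simp [minner]

theorem minner_add_left (A B C : Matrix ι κ ℝ) : minner (A + B) C = minner A C + minner B C := by
  simp only [minner_comm _ C, minner_add_right]

theorem minner_sub_left (A B C : Matrix ι κ ℝ) : minner (A - B) C = minner A C - minner B C := by
  simp only [minner_comm _ C, minner_sub_right]

theorem minner_smul_left (s : ℝ) (A B : Matrix ι κ ℝ) : minner (s • A) B = s * minner A B := by
  simp only [minner_comm _ B, minner_smul_right]

theorem minner_self_nonneg (A : Matrix ι κ ℝ) : 0 ≤ minner A A := by
  rw [minner_eq_sum]
  exact Finset.sum_nonneg fun i _ => Finset.sum_nonneg fun j _ => mul_self_nonneg _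

theorem sq_le_minner_self (A : Matrix ι κ ℝ) (i : ι) (j : κ) : A i j ^ 2 ≤ minner A A := by
  rw [minner_eq_sum, pow_two]
  exact (Finset.single_le_sum (f := fun j => A i j * A i j) (fun j _ => mul_self_nonneg _)
    (Finset.mem_univ j)).trans (Finset.single_le_sum (f := fun i => ∑ j, A i j * A i j)
    (fun i _ => Finset.sum_nonneg fun j _ => mul_self_nonneg _) (Finset.mem_univ i))

theorem eq_zero_of_minner_self_nonpos {A : Matrix ι κ ℝ} (h : minner A A ≤ 0) : A = 0 := by
  ext i j
  have := (sq_le_minner_self A i j).trans h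
  simpa using this

theorem fnorm_sq (A : Matrix ι κ ℝ) : fnorm A ^ 2 = minner A A :=
  Real.sq_sqrt (minner_self_nonneg A)

theorem minner_add_smul_sub_self (P W E h : Matrix ι κ ℝ) (t : ℝ) :
    minner (P + t • h - (P + W + t • E)) (P + t • h - (P + W + t • E))
      = t ^ 2 * minner (h - E) (h - E) - 2 * t * minner W h + 2 * t * minner W E
        + minner W W := by
  have h1 : P + t • h - (P + W + t • E) = t • (h - E) - W := by
    rw [smul_sub]
    abel
  rw [h1]
  simp only [minner_sub_left, minner_sub_right, minner_smul_left, minner_smul_right,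
    minner_comm h W, minner_comm E W]
  ring

theorem continuous_minner {X : Type*} [TopologicalSpace X] {f g : X → Matrix ι κ ℝ}
    (hf : Continuous f) (hg : Continuous g) : Continuous fun x => minner (f x) (g x) :=
  (hf.matrix_transpose.matrix_mul hg).matrix_trace

theorem isCompact_minner_le (E : Matrix ι κ ℝ) (c : ℝ) :
    IsCompact {h : Matrix ι κ ℝ | minner (h - E) (h - E) ≤ c} := by
  have hbox : IsCompact (Set.pi univ fun i => Set.pi univ fun j =>
      Icc (E i j - (|c| + 1)) (E i j + (|c| + 1)) : Set (Matrix ι κ ℝ)) :=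
    isCompact_univ_pi fun i => isCompact_univ_pi fun j => isCompact_Icc
  refine hbox.of_isClosed_subset (isClosed_le (continuous_minner (continuous_id.sub
    continuous_const) (continuous_id.sub continuous_const)) continuous_const) ?_
  intro (h : Matrix ι κ ℝ) hh i _ j _
  have h1 := (sq_le_minner_self (h - E) i j).trans (show _ ≤ c from hh)
  rw [Matrix.sub_apply] at h1
  have h2 : |h i j - E i j| ≤ |c| + 1 := by
    refine abs_le_of_sq_le_sq ?_ (by positivity)
    nlinarith [le_abs_self c, abs_nonneg c]
  rw [abs_le] at h2
  constructor <;> linarith [h2.1, h2.2]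

theorem bddAbove_specNorm_set (A : Matrix ι κ ℝ) :
    BddAbove {r : ℝ | ∃ x : κ → ℝ, ∑ j, x j ^ 2 = 1 ∧
      r = Real.sqrt (∑ i, (∑ j, A i j * x j) ^ 2)} := by
  refine ⟨Real.sqrt (∑ i, ∑ j, A i j ^ 2), ?_⟩
  rintro r ⟨x, hx, rfl⟩
  refine Real.sqrt_le_sqrt (Finset.sum_le_sum fun i _ => ?_)
  simpa [hx] using Finset.sum_mul_sq_le_sq_mul_sq Finset.univ (A i) x

theorem specNorm_nonneg (A : Matrix ι κ ℝ) : 0 ≤ specNorm A := by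
  refine Real.sSup_nonneg ?_
  rintro r ⟨x, -, rfl⟩
  exact Real.sqrt_nonneg _

theorem sum_sq_mulVec_le (A : Matrix ι κ ℝ) (v : κ → ℝ) :
    ∑ i, (∑ j, A i j * v j) ^ 2 ≤ specNorm A ^ 2 * ∑ j, v j ^ 2 := by
  rcases (Finset.sum_nonneg fun j _ => sq_nonneg (v j) : 0 ≤ ∑ j, v j ^ 2).eq_or_lt with h | h
  · have hv : ∀ j, v j = 0 := fun j => by
      simpa using (Finset.sum_eq_zero_iff_of_nonneg fun j _ => sq_nonneg (v j)).1 h.symm j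
        (Finset.mem_univ j)
    simp [hv]
  · set s := ∑ j, v j ^ 2
    have hs : 0 < Real.sqrt s := Real.sqrt_pos.2 h
    have hss : Real.sqrt s ^ 2 = s := Real.sq_sqrt h.le
    have hle : Real.sqrt (∑ i, (∑ j, A i j * ((Real.sqrt s)⁻¹ * v j)) ^ 2) ≤ specNorm A := by
      refine le_csSup (bddAbove_specNorm_set A) ⟨fun j => (Real.sqrt s)⁻¹ * v j, ?_, rfl⟩
      simp only [mul_pow, ← Finset.mul_sum, inv_pow, hss]
      exact inv_mul_cancel₀ h.ne'
    rw [Real.sqrt_le_left (specNorm_nonneg A)] at hle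
    have e : ∀ i, (∑ j, A i j * ((Real.sqrt s)⁻¹ * v j)) ^ 2
        = s⁻¹ * (∑ j, A i j * v j) ^ 2 := by
      intro i
      have hinv : s⁻¹ = (Real.sqrt s)⁻¹ ^ 2 := by rw [inv_pow, hss]
      rw [hinv, ← mul_pow, Finset.mul_sum]
      congr 1
      exact Finset.sum_congr rfl fun j _ => by ring
    simp only [e, ← Finset.mul_sum] at hle
    rwa [inv_mul_le_iff₀ h, mul_comm] at hle

theorem norm_sq_sum (x : EuclideanSpace ℝ (ι ⊕ κ)) :
    ‖x‖ ^ 2 = ∑ i, x (Sum.inl i) ^ 2 + ∑ j, x (Sum.inr j) ^ 2 := by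
  rw [EuclideanSpace.real_norm_sq_eq, Fintype.sum_sum_type]

theorem specNorm_pos {P : Matrix ι κ ℝ} (hP : P ≠ 0) : 0 < specNorm P := by
  classical
  refine (specNorm_nonneg P).lt_of_ne fun h0 => hP ?_
  ext i j
  have h := sum_sq_mulVec_le P (Pi.single j 1)
  rw [← h0] at h
  simp only [Pi.single_apply, mul_ite, mul_one, mul_zero, Finset.sum_ite_eq', Finset.mem_univ,
    if_true, ne_eq, OfNat.ofNat_ne_zero, not_false_eq_true, zero_pow, zero_mul] at h
  have h2 := (Finset.single_le_sum (f := fun i => P i j ^ 2) (fun i _ => sq_nonneg _)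
    (Finset.mem_univ i)).trans h
  simpa using h2

variable [DecidableEq ι] [DecidableEq κ]

/-- The symmetric dilation `[0 M; Mᵀ 0]` of a rectangular matrix, as an operator. -/
noncomputable def dilation : Matrix ι κ ℝ →ₗ[ℝ]
    (EuclideanSpace ℝ (ι ⊕ κ) →L[ℝ] EuclideanSpace ℝ (ι ⊕ κ)) where
  toFun M := Matrix.toEuclideanCLM (𝕜 := ℝ) (Matrix.fromBlocks 0 M Mᵀ 0)
  map_add' A B := by
    rw [← map_add, Matrix.fromBlocks_add]
    simp
  map_smul' s A := by
    rw [RingHom.id_apply, ← map_smul, Matrix.fromBlocks_smul]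
    simp

theorem inner_dilation (M : Matrix ι κ ℝ) (x y : EuclideanSpace ℝ (ι ⊕ κ)) :
    ⟪x, dilation M y⟫
      = ∑ i, ∑ j, M i j * (x (Sum.inl i) * y (Sum.inr j) + y (Sum.inl i) * x (Sum.inr j)) := by
  have h : ∀ k, dilation M y k = (Matrix.fromBlocks 0 M Mᵀ 0 *ᵥ y.ofLp) k := fun k => rfl
  rw [PiLp.inner_apply, Fintype.sum_sum_type]
  simp only [h, Matrix.mulVec, dotProduct, Fintype.sum_sum_type, Matrix.fromBlocks_apply₁₁,
    Matrix.fromBlocks_apply₁₂, Matrix.fromBlocks_apply₂₁, Matrix.fromBlocks_apply₂₂,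
    Matrix.zero_apply, zero_mul, Finset.sum_const_zero, zero_add, add_zero,
    Matrix.transpose_apply, RCLike.inner_apply, conj_trivial,
    mul_add, Finset.sum_add_distrib, Finset.sum_mul]
  congr 1
  · exact Finset.sum_congr rfl fun i _ => Finset.sum_congr rfl fun j _ => by ring
  · rw [Finset.sum_comm]
    exact Finset.sum_congr rfl fun i _ => Finset.sum_congr rfl fun j _ => by ring

theorem dilation_symm (M : Matrix ι κ ℝ) (x y : EuclideanSpace ℝ (ι ⊕ κ)) :
    ⟪dilation M x, y⟫ = ⟪x, dilation M y⟫ := by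
  rw [real_inner_comm, inner_dilation, inner_dilation]
  exact Finset.sum_congr rfl fun i _ => Finset.sum_congr rfl fun j _ => by ring

theorem inner_dilation_self (M : Matrix ι κ ℝ) (x : EuclideanSpace ℝ (ι ⊕ κ)) :
    ⟪x, dilation M x⟫ = 2 * ∑ i, x (Sum.inl i) * ∑ j, M i j * x (Sum.inr j) := by
  rw [inner_dilation, Finset.mul_sum]
  refine Finset.sum_congr rfl fun i _ => ?_
  rw [Finset.mul_sum, Finset.mul_sum]
  exact Finset.sum_congr rfl fun j _ => by ring

theorem inner_dilation_le (M : Matrix ι κ ℝ) (x : EuclideanSpace ℝ (ι ⊕ κ)) :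
    ⟪x, dilation M x⟫ ≤ specNorm M * ‖x‖ ^ 2 := by
  rw [inner_dilation_self, norm_sq_sum]
  have h1 := Finset.sum_mul_sq_le_sq_mul_sq Finset.univ (fun i => x (Sum.inl i))
    (fun i => ∑ j, M i j * x (Sum.inr j))
  have h2 := sum_sq_mulVec_le M fun j => x (Sum.inr j)
  have h3 : 0 ≤ ∑ i, x (Sum.inl i) ^ 2 := Finset.sum_nonneg fun _ _ => sq_nonneg _
  have h4 : 0 ≤ ∑ j, x (Sum.inr j) ^ 2 := Finset.sum_nonneg fun _ _ => sq_nonneg _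
  have h5 := specNorm_nonneg M
  set a := ∑ i, x (Sum.inl i) ^ 2
  set b := ∑ j, x (Sum.inr j) ^ 2
  refine (le_abs_self _).trans (abs_le_of_sq_le_sq ?_ (by positivity))
  have h6 := mul_le_mul_of_nonneg_left h2 h3
  have h7 : 0 ≤ specNorm M ^ 2 * (a - b) ^ 2 := by positivity
  nlinarith

theorem specNorm_le_of_inner_dilation_le [Nonempty κ] {M : Matrix ι κ ℝ} {c : ℝ}
    (h : ∀ x : EuclideanSpace ℝ (ι ⊕ κ), ⟪x, dilation M x⟫ ≤ c * ‖x‖ ^ 2) : specNorm M ≤ c := by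
  have test : ∀ (u : ι → ℝ) (v : κ → ℝ), 2 * ∑ i, u i * ∑ j, M i j * v j
      ≤ c * (∑ i, u i ^ 2 + ∑ j, v j ^ 2) := by
    intro u v
    have := h (WithLp.toLp 2 (Sum.elim u v))
    rw [inner_dilation_self, norm_sq_sum] at this
    simpa using this
  have hc : 0 ≤ c := by
    have := test 0 (Pi.single (Classical.arbitrary κ) 1)
    simpa [Pi.single_apply, ite_pow] using this
  refine Real.sSup_le ?_ hc
  rintro r ⟨v, hv, rfl⟩
  set s := ∑ i, (∑ j, M i j * v j) ^ 2
  have hs : 0 ≤ s := Finset.sum_nonneg fun _ _ => sq_nonneg _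
  have hss : Real.sqrt s ^ 2 = s := Real.sq_sqrt hs
  have := test (fun i => ∑ j, M i j * v j) (fun j => Real.sqrt s * v j)
  have e1 : ∀ i, ∑ j, M i j * (Real.sqrt s * v j) = Real.sqrt s * ∑ j, M i j * v j := by
    intro i
    rw [Finset.mul_sum]
    exact Finset.sum_congr rfl fun j _ => by ring
  have e2 : ∑ i, (∑ j, M i j * v j) * (Real.sqrt s * ∑ j, M i j * v j) = Real.sqrt s * s := by
    rw [Finset.mul_sum]
    exact Finset.sum_congr rfl fun j _ => by ring
  simp only [e1, e2, mul_pow, ← Finset.mul_sum, hv, hss, mul_one] at this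
  change 2 * (Real.sqrt s * s) ≤ c * (s + s) at this
  rcases hs.eq_or_lt with h0 | h0
  · rw [← h0]
    simpa using hc
  · exact le_of_mul_le_mul_right (by linarith) h0

theorem specNorm_add_le [Nonempty κ] (A B : Matrix ι κ ℝ) :
    specNorm (A + B) ≤ specNorm A + specNorm B :=
  specNorm_le_of_inner_dilation_le fun x => by
    rw [map_add, _root_.add_apply, inner_add_right, add_mul]
    exact add_le_add (inner_dilation_le A x) (inner_dilation_le B x)

theorem specNorm_le_norm_dilation [Nonempty κ] (A : Matrix ι κ ℝ) : specNorm A ≤ ‖dilation A‖ :=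
  specNorm_le_of_inner_dilation_le fun x => by
    rw [pow_two]
    exact (le_abs_self _).trans (abs_inner_apply_le _ _ _)

theorem specNorm_zero [Nonempty κ] : specNorm (0 : Matrix ι κ ℝ) = 0 :=
  le_antisymm (by simpa using specNorm_le_norm_dilation (0 : Matrix ι κ ℝ)) (specNorm_nonneg 0)

theorem continuous_dilation : Continuous (dilation (ι := ι) (κ := κ)) :=
  LinearMap.continuous_of_finiteDimensional _

theorem continuous_specNorm [Nonempty κ] : Continuous (specNorm (ι := ι) (κ := κ)) := by
  rw [continuous_iff_continuousAt]
  intro A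
  have h : ∀ B C : Matrix ι κ ℝ, specNorm B - specNorm C ≤ ‖dilation (B - C)‖ := by
    intro B C
    have := specNorm_add_le C (B - C)
    rw [add_sub_cancel] at this
    linarith [specNorm_le_norm_dilation (B - C)]
  rw [ContinuousAt, tendsto_iff_norm_sub_tendsto_zero]
  have hlim : Tendsto (fun B : Matrix ι κ ℝ => ‖dilation (B - A)‖) (nhds A) (nhds 0) := by
    have : Continuous fun B : Matrix ι κ ℝ => ‖dilation (B - A)‖ :=
      (continuous_dilation.comp (continuous_id.sub continuous_const)).norm
    simpa using this.tendsto A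
  refine squeeze_zero (fun _ => norm_nonneg _) (fun B => ?_) hlim
  rw [Real.norm_eq_abs, abs_le]
  have h1 := h A B
  rw [← neg_sub B A, map_neg, norm_neg] at h1
  constructor <;> linarith [h B A]

open scoped MatrixOrder in
/-- The dual unit ball of the spectral norm consists of the off-diagonal parts of positive
semidefinite matrices of trace one. -/
theorem exists_sum_inner_dilation [Nonempty κ] {W : Matrix ι κ ℝ}
    (hW : ∀ M, minner W M ≤ specNorm M) :
    ∃ x : ι ⊕ κ → EuclideanSpace ℝ (ι ⊕ κ), ∑ k, ‖x k‖ ^ 2 = 1 ∧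
      ∀ M, minner W M = ∑ k, ⟪x k, dilation M (x k)⟫ := by
  set Ψ : Matrix (ι ⊕ κ) (ι ⊕ κ) ℝ → Matrix ι κ ℝ := fun Y => (2 : ℝ) • Y.toBlocks₁₂ with hΨ
  set K : Set (Matrix ι κ ℝ) :=
    (fun C : Matrix (ι ⊕ κ) (ι ⊕ κ) ℝ => Ψ (Cᵀ * C)) '' {C | minner C C = 1}
  have hpair : ∀ (C : Matrix (ι ⊕ κ) (ι ⊕ κ) ℝ) (M : Matrix ι κ ℝ), minner (Ψ (Cᵀ * C)) M
      = ∑ k, ⟪WithLp.toLp 2 (C k), dilation M (WithLp.toLp 2 (C k))⟫ := by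
    intro C M
    simp only [inner_dilation, minner_eq_sum]
    rw [Finset.sum_comm (s := (Finset.univ : Finset (ι ⊕ κ)))]
    refine Finset.sum_congr rfl fun i _ => ?_
    rw [Finset.sum_comm (s := (Finset.univ : Finset (ι ⊕ κ)))]
    refine Finset.sum_congr rfl fun j _ => ?_
    simp only [hΨ, Matrix.smul_apply, Matrix.toBlocks₁₂, Matrix.of_apply, Matrix.mul_apply,
      Matrix.transpose_apply, smul_eq_mul, Finset.mul_sum, Finset.sum_mul]
    exact Finset.sum_congr rfl fun k _ => by ring
  have hnorm : ∀ C : Matrix (ι ⊕ κ) (ι ⊕ κ) ℝ,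
      minner C C = ∑ k, ‖(WithLp.toLp 2 (C k) : EuclideanSpace ℝ (ι ⊕ κ))‖ ^ 2 := by
    intro C
    simp only [minner_eq_sum, EuclideanSpace.real_norm_sq_eq, ← pow_two]
  have hKc : IsClosed K := by
    have hc : IsCompact {C : Matrix (ι ⊕ κ) (ι ⊕ κ) ℝ | minner C C = 1} := by
      refine (isCompact_minner_le 0 1).of_isClosed_subset
        (isClosed_eq (continuous_minner continuous_id continuous_id) continuous_const) ?_
      intro C hC
      simpa using (le_of_eq hC)
    refine (hc.image ?_).isClosed
    refine Continuous.const_smul ?_ (2 : ℝ)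
    have h1 : Continuous fun C : Matrix (ι ⊕ κ) (ι ⊕ κ) ℝ => Cᵀ * C :=
      continuous_id.matrix_transpose.matrix_mul continuous_id
    exact h1.matrix_submatrix Sum.inl Sum.inr
  have hKconv : Convex ℝ K := by
    rintro _ ⟨C, hC, rfl⟩ _ ⟨C', hC', rfl⟩ a b ha hb hab
    have hpsd : (a • (Cᵀ * C) + b • (C'ᵀ * C')).PosSemidef := by
      have h1 := Matrix.posSemidef_conjTranspose_mul_self C
      have h2 := Matrix.posSemidef_conjTranspose_mul_self C'
      rw [Matrix.conjTranspose_eq_transpose_of_trivial] at h1 h2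
      exact (h1.smul ha).add (h2.smul hb)
    obtain ⟨D, hD⟩ := CStarAlgebra.nonneg_iff_eq_star_mul_self.1
      (Matrix.nonneg_iff_posSemidef.2 hpsd)
    rw [Matrix.star_eq_conjTranspose, Matrix.conjTranspose_eq_transpose_of_trivial] at hD
    refine ⟨D, ?_, ?_⟩
    · show (Dᵀ * D).trace = 1
      rw [← hD, Matrix.trace_add, Matrix.trace_smul, Matrix.trace_smul]
      change minner C C = 1 at hC
      change minner C' C' = 1 at hC'
      rw [minner] at hC hC'
      rw [hC, hC']
      simpa using hab
    · show Ψ (Dᵀ * D) = a • Ψ (Cᵀ * C) + b • Ψ (C'ᵀ * C')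
      rw [← hD]
      ext i j
      simp only [hΨ, Matrix.toBlocks₁₂, Matrix.smul_apply, Matrix.add_apply, Matrix.of_apply,
        smul_eq_mul]
      ring
  by_cases hmem : W ∈ K
  · obtain ⟨C, hC, rfl⟩ := hmem
    exact ⟨fun k => WithLp.toLp 2 (C k), (hnorm C).symm.trans hC, hpair C⟩
  exfalso
  have : LocallyConvexSpace ℝ (Matrix ι κ ℝ) := inferInstanceAs (LocallyConvexSpace ℝ (ι → κ → ℝ))
  obtain ⟨f, u, hfW, hfK⟩ := geometric_hahn_banach_point_closed hKconv hKc hmem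
  set M : Matrix ι κ ℝ := Matrix.of fun i j => -f (Matrix.single i j 1)
  have hf : ∀ X, f X = -minner X M := by
    intro X
    have hX : X = ∑ i, ∑ j, X i j • Matrix.single i j (1 : ℝ) := by
      conv_lhs => rw [Matrix.matrix_eq_sum_single X]
      simp
    conv_lhs => rw [hX]
    simp only [map_sum, map_smul, minner_eq_sum, M, Matrix.of_apply, smul_eq_mul, mul_neg,
      Finset.sum_neg_distrib, neg_neg]
  have hM : specNorm M ≤ -u := by
    refine specNorm_le_of_inner_dilation_le fun x => ?_
    rcases eq_or_ne x 0 with rfl | hx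
    · simp
    have hn : 0 < ‖x‖ := norm_pos_iff.2 hx
    set y := ‖x‖⁻¹ • x with hy
    have hyn : ‖y‖ = 1 := by simp [hy, norm_smul, hn.ne']
    set k₀ : ι ⊕ κ := Sum.inr (Classical.arbitrary κ)
    set C : Matrix (ι ⊕ κ) (ι ⊕ κ) ℝ := Matrix.of fun k l => if k = k₀ then y l else 0
    have hCk : ∀ k, (WithLp.toLp 2 (C k) : EuclideanSpace ℝ (ι ⊕ κ)) = if k = k₀ then y else 0 := by
      intro k
      ext l
      by_cases h : k = k₀ <;> simp [C, h]
    have hC1 : minner C C = 1 := by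
      rw [hnorm, Finset.sum_eq_single k₀]
      · simp [hCk, hyn]
      · intro k _ hk
        simp [hCk, hk]
      · simp
    have h1 := hfK _ ⟨C, hC1, rfl⟩
    rw [hf, hpair, Finset.sum_eq_single k₀] at h1
    · rw [hCk, if_pos rfl, hy, map_smul, real_inner_smul_left, real_inner_smul_right] at h1
      have h2 : ‖x‖⁻¹ * (‖x‖⁻¹ * ⟪x, dilation M x⟫) ≤ -u := by linarith
      rw [inv_mul_le_iff₀ hn, inv_mul_le_iff₀ hn] at h2
      linarith
    · intro k _ hk
      simp [hCk, hk]
    · simp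
  have := hW M
  rw [hf] at hfW
  linarith

/-- Every quadratic form coincides, on the leading singular pairs of `P`, with the quadratic form of
the dilation of some matrix. -/
theorem exists_dilation_eq_on_ker {P : Matrix ι κ ℝ} {l : ℝ} (hl : l ≠ 0)
    (O : EuclideanSpace ℝ (ι ⊕ κ) →L[ℝ] EuclideanSpace ℝ (ι ⊕ κ)) :
    ∃ Z : Matrix ι κ ℝ, ∀ e, dilation P e = l • e → ⟪e, dilation Z e⟫ = ⟪e, O e⟫ := by
  set B := (Matrix.toEuclideanCLM (n := ι ⊕ κ) (𝕜 := ℝ)).symm O with hB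
  refine ⟨(1 / 2 : ℝ) • (l⁻¹ • (B.toBlocks₁₁ * P) + B.toBlocks₁₂ + B.toBlocks₂₁ᵀ
    + l⁻¹ • (P * B.toBlocks₂₂)), fun e he => ?_⟩
  set u : ι → ℝ := fun i => e (Sum.inl i) with hu
  set v : κ → ℝ := fun j => e (Sum.inr j) with hv
  have hdil : ∀ k, (Matrix.fromBlocks 0 P Pᵀ 0 *ᵥ e.ofLp) k = l * e k := by
    intro k
    have h1 : dilation P e k = (Matrix.fromBlocks 0 P Pᵀ 0 *ᵥ e.ofLp) k := rfl
    rw [← h1, he]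
    simp
  have hev : e.ofLp = Sum.elim u v := by
    ext k
    cases k <;> rfl
  rw [hev, Matrix.fromBlocks_mulVec] at hdil
  have hPv : P *ᵥ v = l • u := by
    ext i
    simpa using hdil (Sum.inl i)
  have hPu : u ᵥ* P = l • v := by
    ext j
    simpa [Matrix.mulVec_transpose] using hdil (Sum.inr j)
  have hform : ∀ M : Matrix ι κ ℝ, ⟪e, dilation M e⟫ = 2 * (u ⬝ᵥ M *ᵥ v) := by
    intro M
    rw [inner_dilation_self]
    rfl
  have hO : ⟪e, O e⟫ = u ⬝ᵥ B.toBlocks₁₁ *ᵥ u + u ⬝ᵥ B.toBlocks₁₂ *ᵥ v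
      + v ⬝ᵥ B.toBlocks₂₁ *ᵥ u + v ⬝ᵥ B.toBlocks₂₂ *ᵥ v := by
    have h1 : O = Matrix.toEuclideanCLM (n := ι ⊕ κ) (𝕜 := ℝ) B := by simp [hB]
    have h2 : ⟪e, O e⟫ = e.ofLp ⬝ᵥ B *ᵥ e.ofLp := by
      rw [h1, real_inner_comm]
      rfl
    rw [h2, hev, ← Matrix.fromBlocks_toBlocks B, Matrix.fromBlocks_mulVec]
    simp [Sum.elim_add_add, dotProduct, Fintype.sum_sum_type,
      Finset.sum_add_distrib, mul_add]
    ring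
  have h1 : u ⬝ᵥ (B.toBlocks₁₁ * P) *ᵥ v = l * (u ⬝ᵥ B.toBlocks₁₁ *ᵥ u) := by
    rw [← Matrix.mulVec_mulVec, hPv, Matrix.mulVec_smul, dotProduct_smul, smul_eq_mul]
  have h2 : u ⬝ᵥ (P * B.toBlocks₂₂) *ᵥ v = l * (v ⬝ᵥ B.toBlocks₂₂ *ᵥ v) := by
    rw [← Matrix.mulVec_mulVec, Matrix.dotProduct_mulVec, hPu, smul_dotProduct, smul_eq_mul]
  have h3 : u ⬝ᵥ B.toBlocks₂₁ᵀ *ᵥ v = v ⬝ᵥ B.toBlocks₂₁ *ᵥ u := by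
    rw [Matrix.mulVec_transpose, dotProduct_comm, ← Matrix.dotProduct_mulVec]
  rw [hform, hO]
  simp only [Matrix.smul_mulVec, Matrix.add_mulVec, dotProduct_smul, dotProduct_add, smul_eq_mul,
    h1, h2, h3]
  field_simp

end SpectralNorm

section SecondOrder

variable {ι κ : Type*} [Fintype ι] [Fintype κ] [DecidableEq ι] [DecidableEq κ]

theorem inner_dilation_add (A B : Matrix ι κ ℝ) (x y : EuclideanSpace ℝ (ι ⊕ κ)) :
    ⟪x, dilation (A + B) y⟫ = ⟪x, dilation A y⟫ + ⟪x, dilation B y⟫ := by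
  rw [map_add dilation, _root_.add_apply, inner_add_right]

theorem inner_dilation_smul (s : ℝ) (A : Matrix ι κ ℝ) (x y : EuclideanSpace ℝ (ι ⊕ κ)) :
    ⟪x, dilation (s • A) y⟫ = s * ⟪x, dilation A y⟫ := by
  rw [map_smul dilation, _root_.smul_apply, real_inner_smul_right]

/-- The positive semidefinite operator `‖P‖₂ I - dilation P`. -/
noncomputable def normGap (P : Matrix ι κ ℝ) :
    EuclideanSpace ℝ (ι ⊕ κ) →L[ℝ] EuclideanSpace ℝ (ι ⊕ κ) :=
  specNorm P • ContinuousLinearMap.id ℝ _ - dilation P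

theorem normGap_apply (P : Matrix ι κ ℝ) (e : EuclideanSpace ℝ (ι ⊕ κ)) :
    normGap P e = specNorm P • e - dilation P e :=
  rfl

theorem normGap_symm (P : Matrix ι κ ℝ) (x y : EuclideanSpace ℝ (ι ⊕ κ)) :
    ⟪normGap P x, y⟫ = ⟪x, normGap P y⟫ := by
  simp only [normGap_apply, inner_sub_left, inner_sub_right, real_inner_smul_left,
    real_inner_smul_right, dilation_symm]

theorem inner_normGap_self (P : Matrix ι κ ℝ) (x : EuclideanSpace ℝ (ι ⊕ κ)) :
    ⟪x, normGap P x⟫ = specNorm P * ‖x‖ ^ 2 - ⟪x, dilation P x⟫ := by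
  rw [normGap_apply, inner_sub_right, real_inner_smul_right, real_inner_self_eq_norm_sq]

theorem inner_normGap_self_nonneg (P : Matrix ι κ ℝ) (x : EuclideanSpace ℝ (ι ⊕ κ)) :
    0 ≤ ⟪x, normGap P x⟫ := by
  rw [inner_normGap_self]
  exact sub_nonneg.2 (inner_dilation_le P x)

/-- Second-order lower bound of the spectral norm along a ray, tested at a vector of the kernel. -/
theorem le_specNorm_add_smul_mul_norm_sq [Nonempty κ] {P : Matrix ι κ ℝ}
    {R : EuclideanSpace ℝ (ι ⊕ κ) →L[ℝ] EuclideanSpace ℝ (ι ⊕ κ)}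
    (hR : IsSymmPinv (normGap P) R) {u : EuclideanSpace ℝ (ι ⊕ κ)} (hu : normGap P u = 0)
    {h : Matrix ι κ ℝ} {b : ℝ} (hb : ‖dilation h‖ ≤ b) {t : ℝ} (ht : 0 < t) :
    specNorm P * ‖u‖ ^ 2 + t * ⟪u, dilation h u⟫ + t ^ 2 * ⟪dilation h u, R (dilation h u)⟫
      - 2 * ‖R‖ ^ 2 * b ^ 3 * t ^ 3 * ‖u‖ ^ 2 ≤ specNorm (P + t • h) * ‖u‖ ^ 2 := by
  have hb0 : 0 ≤ b := (norm_nonneg _).trans hb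
  have h1 := inner_test_vector (normGap_symm P) hR (dilation_symm h) hu t
  have h2 := norm_sq_test_vector hR hu (dilation h u) t
  set w := R (dilation h u)
  have hwn : ‖w‖ ≤ ‖R‖ * (b * ‖u‖) := by
    refine (R.le_opNorm _).trans (mul_le_mul_of_nonneg_left ?_ (norm_nonneg _))
    exact ((dilation h).le_opNorm _).trans (mul_le_mul_of_nonneg_right hb (norm_nonneg _))
  have hwn2 : ‖w‖ ^ 2 ≤ ‖R‖ ^ 2 * b ^ 2 * ‖u‖ ^ 2 := by
    calc ‖w‖ ^ 2 ≤ (‖R‖ * (b * ‖u‖)) ^ 2 := pow_le_pow_left₀ (norm_nonneg _) hwn 2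
      _ = _ := by ring
  have h3 := inner_dilation_le (P + t • h) (u + t • w)
  have h4 : ⟪u + t • w, dilation (P + t • h) (u + t • w)⟫
      = ⟪u + t • w, dilation P (u + t • w)⟫ + t * ⟪u + t • w, dilation h (u + t • w)⟫ := by
    rw [inner_dilation_add, inner_dilation_smul]
  rw [inner_normGap_self] at h1
  have h5 : specNorm (P + t • h) ≤ specNorm P + t * b := by
    refine (specNorm_add_le _ _).trans (add_le_add_right ((specNorm_le_norm_dilation _).trans ?_) _)
    rw [map_smul, norm_smul, Real.norm_of_nonneg ht.le]
    exact mul_le_mul_of_nonneg_left hb ht.le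
  have h6 : -(b * ‖w‖ ^ 2) ≤ ⟪w, dilation h w⟫ := by
    have := (abs_le.1 (abs_inner_apply_le (dilation h) w w)).1
    nlinarith [mul_le_mul_of_nonneg_right hb (sq_nonneg ‖w‖)]
  rw [h4, h2] at h3
  rw [h2] at h1
  have h7 : (specNorm (P + t • h) - specNorm P) * (t ^ 2 * ‖w‖ ^ 2)
      ≤ t * b * (t ^ 2 * ‖w‖ ^ 2) :=
    mul_le_mul_of_nonneg_right (by linarith) (by positivity)
  have h8 : t ^ 3 * (-(b * ‖w‖ ^ 2)) ≤ t ^ 3 * ⟪w, dilation h w⟫ :=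
    mul_le_mul_of_nonneg_left h6 (by positivity)
  have h9 : (2 * b * t ^ 3) * ‖w‖ ^ 2 ≤ (2 * b * t ^ 3) * (‖R‖ ^ 2 * b ^ 2 * ‖u‖ ^ 2) :=
    mul_le_mul_of_nonneg_left hwn2 (by positivity)
  nlinarith

/-- A decomposition of a subgradient `W` of the spectral norm at `P` over vectors of the kernel of
`normGap P`, together with a pseudoinverse of `normGap P`. -/
structure IsSubgradDecomp (P W : Matrix ι κ ℝ)
    (R : EuclideanSpace ℝ (ι ⊕ κ) →L[ℝ] EuclideanSpace ℝ (ι ⊕ κ))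
    (x : ι ⊕ κ → EuclideanSpace ℝ (ι ⊕ κ)) : Prop where
  pos : 0 < specNorm P
  pinv : IsSymmPinv (normGap P) R
  ker : ∀ k, normGap P (x k) = 0
  sum_sq : ∑ k, ‖x k‖ ^ 2 = 1
  minner_eq : ∀ M, minner W M = ∑ k, ⟪x k, dilation M (x k)⟫

theorem exists_isSubgradDecomp [Nonempty κ] {P W : Matrix ι κ ℝ} (hP : P ≠ 0)
    (hW : W ∈ subdiff specNorm P) : ∃ R x, IsSubgradDecomp P W R x := by
  obtain ⟨R, hR⟩ := exists_isSymmPinv (normGap P) (normGap_symm P)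
  have hW1 : ∀ M, minner W M ≤ specNorm M := by
    intro M
    have h1 := hW (P + M)
    rw [add_sub_cancel_left] at h1
    linarith [specNorm_add_le P M]
  have hW2 : specNorm P ≤ minner W P := by
    have h1 := hW 0
    rw [specNorm_zero, minner_sub_right] at h1
    have h2 : minner W 0 = 0 := by simp [minner]
    linarith
  obtain ⟨x, hx, hWx⟩ := exists_sum_inner_dilation hW1
  refine ⟨R, x, specNorm_pos hP, hR, fun k => ?_, hx, hWx⟩
  have hsum : ∑ k, ⟪x k, normGap P (x k)⟫ ≤ 0 := by
    simp only [inner_normGap_self, Finset.sum_sub_distrib, ← Finset.mul_sum, hx, ← hWx]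
    linarith
  have hk : ⟪x k, normGap P (x k)⟫ ≤ 0 :=
    (Finset.single_le_sum (f := fun k => ⟪x k, normGap P (x k)⟫)
      (fun k _ => inner_normGap_self_nonneg P (x k)) (Finset.mem_univ k)).trans hsum
  exact apply_eq_zero_of_inner_self_eq_zero (normGap_symm P) (inner_normGap_self_nonneg P)
    (hk.antisymm (inner_normGap_self_nonneg P _))

/-- The second-order (curvature) form attached to a decomposition of a subgradient. -/
noncomputable def curvForm (R : EuclideanSpace ℝ (ι ⊕ κ) →L[ℝ] EuclideanSpace ℝ (ι ⊕ κ))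
    (x : ι ⊕ κ → EuclideanSpace ℝ (ι ⊕ κ)) (h : Matrix ι κ ℝ) : ℝ :=
  ∑ k, ⟪dilation h (x k), R (dilation h (x k))⟫

/-- The critical cone, described on the kernel of `normGap P`. -/
def kerCone (P W : Matrix ι κ ℝ) : Set (Matrix ι κ ℝ) :=
  {h | ∀ e, normGap P e = 0 → ⟪e, dilation h e⟫ ≤ minner W h * ‖e‖ ^ 2}

namespace IsSubgradDecomp

variable {P W : Matrix ι κ ℝ} {R : EuclideanSpace ℝ (ι ⊕ κ) →L[ℝ] EuclideanSpace ℝ (ι ⊕ κ)}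
  {x : ι ⊕ κ → EuclideanSpace ℝ (ι ⊕ κ)}

theorem le_specNorm_add_smul [Nonempty κ] (hd : IsSubgradDecomp P W R x)
    {h : Matrix ι κ ℝ} {b : ℝ} (hb : ‖dilation h‖ ≤ b) {t : ℝ} (ht : 0 < t) :
    specNorm P + t * minner W h + t ^ 2 * curvForm R x h - 2 * ‖R‖ ^ 2 * b ^ 3 * t ^ 3
      ≤ specNorm (P + t • h) := by
  have h1 := Finset.sum_le_sum fun k (_ : k ∈ Finset.univ) =>
    le_specNorm_add_smul_mul_norm_sq hd.pinv (hd.ker k) hb ht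
  simp only [Finset.sum_sub_distrib, Finset.sum_add_distrib, ← Finset.mul_sum, hd.sum_sq,
    ← hd.minner_eq, mul_one] at h1
  exact h1

theorem curvForm_nonneg (hd : IsSubgradDecomp P W R x) (h : Matrix ι κ ℝ) :
    0 ≤ curvForm R x h :=
  Finset.sum_nonneg fun _ _ => hd.pinv.inner_self_nonneg (inner_normGap_self_nonneg P) _

theorem inner_dilation_eq (hd : IsSubgradDecomp P W R x) {H : Matrix ι κ ℝ}
    (hH : H ∈ kerCone P W) (k : ι ⊕ κ) : ⟪x k, dilation H (x k)⟫ = minner W H * ‖x k‖ ^ 2 := by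
  have h1 : ∑ k, (minner W H * ‖x k‖ ^ 2 - ⟪x k, dilation H (x k)⟫) = 0 := by
    rw [Finset.sum_sub_distrib, ← Finset.mul_sum, hd.sum_sq, ← hd.minner_eq, mul_one, sub_self]
  have h2 := (Finset.sum_eq_zero_iff_of_nonneg fun k _ =>
    sub_nonneg.2 (hH (x k) (hd.ker k))).1 h1 k (Finset.mem_univ k)
  linarith

theorem exists_ne_zero (hd : IsSubgradDecomp P W R x) : ∃ k, x k ≠ 0 := by
  by_contra! hx
  have := hd.sum_sq
  simp [hx] at this

end IsSubgradDecomp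

theorem curvForm_smul (R : EuclideanSpace ℝ (ι ⊕ κ) →L[ℝ] EuclideanSpace ℝ (ι ⊕ κ))
    (x : ι ⊕ κ → EuclideanSpace ℝ (ι ⊕ κ)) (s : ℝ) (h : Matrix ι κ ℝ) :
    curvForm R x (s • h) = s ^ 2 * curvForm R x h := by
  simp only [curvForm, map_smul, _root_.smul_apply, real_inner_smul_left,
    real_inner_smul_right, Finset.mul_sum]
  exact Finset.sum_congr rfl fun k _ => by ring

theorem continuous_dilation_apply (e : EuclideanSpace ℝ (ι ⊕ κ)) :
    Continuous fun h : Matrix ι κ ℝ => dilation h e :=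
  (ContinuousLinearMap.apply ℝ _ e).continuous.comp continuous_dilation

theorem continuous_curvForm (R : EuclideanSpace ℝ (ι ⊕ κ) →L[ℝ] EuclideanSpace ℝ (ι ⊕ κ))
    (x : ι ⊕ κ → EuclideanSpace ℝ (ι ⊕ κ)) : Continuous (curvForm R x) :=
  continuous_finsetSum _ fun k _ => (continuous_dilation_apply (x k)).inner
    (R.continuous.comp (continuous_dilation_apply (x k)))

/-- The form whose maximum over the unit vectors of `ker (normGap P)` with
`⟪e, dilation H e⟫ = c ‖e‖²` is the second-order directional derivative of the spectral norm. -/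
noncomputable def secForm (R : EuclideanSpace ℝ (ι ⊕ κ) →L[ℝ] EuclideanSpace ℝ (ι ⊕ κ))
    (H Z : Matrix ι κ ℝ) (e : EuclideanSpace ℝ (ι ⊕ κ)) : ℝ :=
  ⟪e, dilation Z e⟫ + 2 * ⟪dilation H e, R (dilation H e)⟫

theorem continuous_secForm (R : EuclideanSpace ℝ (ι ⊕ κ) →L[ℝ] EuclideanSpace ℝ (ι ⊕ κ))
    (H Z : Matrix ι κ ℝ) : Continuous (secForm R H Z) := by
  unfold secForm
  fun_prop

theorem secForm_smul (R : EuclideanSpace ℝ (ι ⊕ κ) →L[ℝ] EuclideanSpace ℝ (ι ⊕ κ))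
    (H Z : Matrix ι κ ℝ) (s : ℝ) (e : EuclideanSpace ℝ (ι ⊕ κ)) :
    secForm R H Z (s • e) = s ^ 2 * secForm R H Z e := by
  simp only [secForm, map_smul, real_inner_smul_left, real_inner_smul_right]
  ring

/-- `ν` is the maximum of `secForm R H Z` over unit vectors of `ker (normGap P)` on which the form
of `dilation H` equals `c`. -/
structure IsSecMax (P : Matrix ι κ ℝ)
    (R : EuclideanSpace ℝ (ι ⊕ κ) →L[ℝ] EuclideanSpace ℝ (ι ⊕ κ)) (H Z : Matrix ι κ ℝ)
    (c ν : ℝ) : Prop where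
  le : ∀ e, normGap P e = 0 → ⟪e, dilation H e⟫ = c * ‖e‖ ^ 2 → secForm R H Z e ≤ ν * ‖e‖ ^ 2
  exists_eq : ∃ e, normGap P e = 0 ∧ ⟪e, dilation H e⟫ = c ∧ ‖e‖ = 1 ∧ secForm R H Z e = ν

namespace IsSubgradDecomp

variable {P W : Matrix ι κ ℝ} {R : EuclideanSpace ℝ (ι ⊕ κ) →L[ℝ] EuclideanSpace ℝ (ι ⊕ κ)}
  {x : ι ⊕ κ → EuclideanSpace ℝ (ι ⊕ κ)}

theorem exists_unit (hd : IsSubgradDecomp P W R x) {H : Matrix ι κ ℝ}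
    (hH : H ∈ kerCone P W) :
    ∃ e, normGap P e = 0 ∧ ⟪e, dilation H e⟫ = minner W H ∧ ‖e‖ = 1 := by
  obtain ⟨k, hk⟩ := hd.exists_ne_zero
  have hk' : ‖x k‖ ≠ 0 := norm_ne_zero_iff.2 hk
  refine ⟨‖x k‖⁻¹ • x k, by rw [map_smul, hd.ker, smul_zero], ?_, ?_⟩
  · rw [map_smul, real_inner_smul_left, real_inner_smul_right, hd.inner_dilation_eq hH]
    field_simp
  · rw [norm_smul, norm_inv, norm_norm, inv_mul_cancel₀ hk']

theorem exists_isSecMax (hd : IsSubgradDecomp P W R x) {H : Matrix ι κ ℝ}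
    (hH : H ∈ kerCone P W) (Z : Matrix ι κ ℝ) : ∃ ν, IsSecMax P R H Z (minner W H) ν := by
  set K : Set (EuclideanSpace ℝ (ι ⊕ κ)) :=
    {e | normGap P e = 0 ∧ ⟪e, dilation H e⟫ = minner W H ∧ ‖e‖ = 1}
  have hK : IsCompact K := by
    refine (isCompact_sphere (0 : EuclideanSpace ℝ (ι ⊕ κ)) 1).of_isClosed_subset ?_
      fun e he => by simpa using he.2.2
    exact (isClosed_eq (normGap P).continuous continuous_const).inter
      ((isClosed_eq (continuous_id.inner (dilation H).continuous) continuous_const).inter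
        (isClosed_eq continuous_norm continuous_const))
  obtain ⟨e₀, he₀, hmax⟩ := hK.exists_isMaxOn (hd.exists_unit hH)
    (continuous_secForm R H Z).continuousOn
  refine ⟨secForm R H Z e₀, fun e he hc => ?_, e₀, he₀.1, he₀.2.1, he₀.2.2, rfl⟩
  rcases eq_or_ne e 0 with rfl | hne
  · simp [secForm]
  have hn : ‖e‖ ≠ 0 := norm_ne_zero_iff.2 hne
  have hmem : ‖e‖⁻¹ • e ∈ K := by
    refine ⟨by rw [map_smul, he, smul_zero], ?_, by rw [norm_smul, norm_inv, norm_norm,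
      inv_mul_cancel₀ hn]⟩
    rw [map_smul, real_inner_smul_left, real_inner_smul_right, hc]
    field_simp
  have h1 : secForm R H Z (‖e‖⁻¹ • e) ≤ secForm R H Z e₀ := hmax hmem
  rwa [secForm_smul, inv_pow, inv_mul_le_iff₀ (by positivity), mul_comm] at h1

theorem eventually_specNorm_le [Nonempty κ] (hd : IsSubgradDecomp P W R x) {H Z : Matrix ι κ ℝ}
    (hH : H ∈ kerCone P W) {ν c : ℝ} (hν : IsSecMax P R H Z (minner W H) ν) (hc : ν < c) :
    ∀ᶠ t in nhdsWithin (0 : ℝ) (Ioi 0),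
      specNorm (P + t • H + (t ^ 2 / 2) • Z) ≤ specNorm P + t * minner W H + t ^ 2 / 2 * c := by
  set A := dilation H - minner W H • ContinuousLinearMap.id ℝ (EuclideanSpace ℝ (ι ⊕ κ))
  set B := dilation Z - c • ContinuousLinearMap.id ℝ (EuclideanSpace ℝ (ι ⊕ κ))
  have hAv : ∀ v, A v = dilation H v - minner W H • v := fun v => rfl
  have hBv : ∀ v, B v = dilation Z v - c • v := fun v => rfl
  have hAf : ∀ v, ⟪v, A v⟫ = ⟪v, dilation H v⟫ - minner W H * ‖v‖ ^ 2 := fun v => by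
    rw [hAv, inner_sub_right, real_inner_smul_right, real_inner_self_eq_norm_sq]
  have hBf : ∀ v, ⟪v, B v⟫ = ⟪v, dilation Z v⟫ - c * ‖v‖ ^ 2 := fun v => by
    rw [hBv, inner_sub_right, real_inner_smul_right, real_inner_self_eq_norm_sq]
  have key := eventually_quadratic_perturbation_nonpos (normGap_symm P)
    (inner_normGap_self_nonneg P) hd.pinv (A := A) (B := B)
    (fun u v => by
      simp only [hAv, inner_sub_left, inner_sub_right, real_inner_smul_left,
        real_inner_smul_right, dilation_symm])
    (fun u v => by
      simp only [hBv, inner_sub_left, inner_sub_right, real_inner_smul_left,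
        real_inner_smul_right, dilation_symm])
    (fun e he => by rw [hAf]; exact sub_nonpos.2 (hH e he))
    (fun e he hne h0 => by
      have hRe := hd.pinv.apply_eq_zero he
      have h1 : ⟪A e, R (A e)⟫ = ⟪dilation H e, R (dilation H e)⟫ := by
        rw [hAv, map_sub, map_smul, hRe, smul_zero, sub_zero, inner_sub_left,
          real_inner_smul_left, ← hd.pinv.symm e, hRe, inner_zero_left, mul_zero, sub_zero]
      have h2 := hν.le e he (by linarith [hAf e])
      have h3 : 0 < ‖e‖ ^ 2 := by positivity
      rw [h1, hBf]
      unfold secForm at h2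
      nlinarith)
  filter_upwards [key] with t ht
  refine specNorm_le_of_inner_dilation_le fun y => ?_
  have h := ht y
  rw [inner_normGap_self, hAf, hBf] at h
  rw [inner_dilation_add, inner_dilation_add, inner_dilation_smul, inner_dilation_smul]
  linarith

theorem tendsto_secondOrder [Nonempty κ] (hd : IsSubgradDecomp P W R x) {H Z : Matrix ι κ ℝ}
    (hH : H ∈ kerCone P W) {ν : ℝ} (hν : IsSecMax P R H Z (minner W H) ν) :
    Tendsto (fun t : ℝ => (specNorm (P + t • H + (t ^ 2 / 2) • Z) - specNorm P - t * minner W H)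
      / (t ^ 2 / 2)) (nhdsWithin 0 (Ioi 0)) (nhds ν) := by
  rw [tendsto_order]
  constructor
  · intro a ha
    obtain ⟨u, hu, huc, hun, huν⟩ := hν.exists_eq
    set b := ‖dilation H‖ + ‖dilation Z‖
    set g : ℝ → ℝ := fun t => secForm R (H + (t / 2) • Z) Z u - 4 * ‖R‖ ^ 2 * b ^ 3 * t with hg
    have hgc : Tendsto g (nhdsWithin 0 (Ioi 0)) (nhds ν) := by
      have hc : Continuous g := by
        have h1 : Continuous fun t : ℝ => dilation (H + (t / 2) • Z) u :=
          (continuous_dilation_apply u).comp (by fun_prop)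
        simp only [hg, secForm]
        fun_prop
      have h0 : g 0 = ν := by simp [hg, huν]
      exact h0 ▸ (hc.tendsto 0).mono_left nhdsWithin_le_nhds
    filter_upwards [hgc.eventually (lt_mem_nhds ha), self_mem_nhdsWithin,
      nhdsWithin_le_nhds (Iio_mem_nhds (zero_lt_one (α := ℝ)))] with t h1 (h2 : 0 < t) (h3 : t < 1)
    refine h1.trans_le ?_
    have hb : ‖dilation (H + (t / 2) • Z)‖ ≤ b := by
      rw [map_add, map_smul]
      refine (norm_add_le _ _).trans (add_le_add_right ?_ _)
      rw [norm_smul, Real.norm_of_nonneg (by positivity)]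
      exact mul_le_of_le_one_left (norm_nonneg _) (by linarith)
    have h4 := le_specNorm_add_smul_mul_norm_sq hd.pinv hu hb h2
    have h5 : P + t • (H + (t / 2) • Z) = P + t • H + (t ^ 2 / 2) • Z := by
      rw [smul_add, smul_smul, ← add_assoc]
      congr 2
      ring
    rw [h5, hun, inner_dilation_add, inner_dilation_smul, huc] at h4
    rw [le_div_iff₀ (by positivity)]
    simp only [hg, secForm]
    nlinarith
  · intro a ha
    obtain ⟨c, hc1, hc2⟩ := exists_between ha
    filter_upwards [hd.eventually_specNorm_le hH hν hc1, self_mem_nhdsWithin] with t h1 (h2 : 0 < t)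
    refine lt_of_le_of_lt ?_ hc2
    rw [div_le_iff₀ (by positivity)]
    linarith

theorem dirDeriv_eq [Nonempty κ] (hd : IsSubgradDecomp P W R x) {H : Matrix ι κ ℝ}
    (hH : H ∈ kerCone P W) : dirDeriv specNorm P H = minner W H := by
  obtain ⟨ν, hν⟩ := hd.exists_isSecMax hH 0
  have h1 := hd.tendsto_secondOrder hH hν
  have h2 : Tendsto (fun t : ℝ => t / 2) (nhdsWithin 0 (Ioi 0)) (nhds 0) := by
    have : Continuous fun t : ℝ => t / 2 := by fun_prop
    simpa using (this.tendsto 0).mono_left nhdsWithin_le_nhds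
  have h3 := (h2.mul h1).const_add (minner W H)
  rw [zero_mul, add_zero] at h3
  refine Tendsto.limUnder_eq (h3.congr' ?_)
  filter_upwards [self_mem_nhdsWithin] with t (ht : 0 < t)
  rw [smul_zero, add_zero]
  field_simp
  ring

theorem dirDeriv2_eq [Nonempty κ] (hd : IsSubgradDecomp P W R x) {H Z : Matrix ι κ ℝ}
    (hH : H ∈ kerCone P W) {ν : ℝ} (hν : IsSecMax P R H Z (minner W H) ν) :
    dirDeriv2 specNorm P H Z = ν := by
  unfold dirDeriv2
  rw [hd.dirDeriv_eq hH]
  exact (hd.tendsto_secondOrder hH hν).limUnder_eq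

theorem mem_critTheta [Nonempty κ] (hd : IsSubgradDecomp P W R x) {H : Matrix ι κ ℝ}
    (hH : H ∈ kerCone P W) : H ∈ critTheta P W :=
  (hd.dirDeriv_eq hH).trans (minner_comm W H)

/-- A direction in which the sigma term is attained. -/
theorem exists_isSecMax_zero (hd : IsSubgradDecomp P W R x) {H : Matrix ι κ ℝ}
    (hH : H ∈ kerCone P W) :
    ∃ Z, IsSecMax P R H Z (minner W H) 0 ∧ minner W Z = -2 * curvForm R x H := by
  obtain ⟨Z, hZ⟩ := exists_dilation_eq_on_ker (P := P) hd.pos.ne'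
    ((-2 : ℝ) • (dilation H ∘L R ∘L dilation H))
  have hZ' : ∀ e, normGap P e = 0 →
      ⟪e, dilation Z e⟫ = -2 * ⟪dilation H e, R (dilation H e)⟫ := by
    intro e he
    rw [hZ e (sub_eq_zero.1 (normGap_apply P e ▸ he)).symm, _root_.smul_apply,
      real_inner_smul_right, dilation_symm]
    rfl
  have hs : ∀ e, normGap P e = 0 → secForm R H Z e = 0 := fun e he => by
    rw [secForm, hZ' e he]
    ring
  refine ⟨Z, ⟨fun e he _ => by rw [hs e he, zero_mul], ?_⟩, ?_⟩
  · obtain ⟨e, he, hc, hn⟩ := hd.exists_unit hH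
    exact ⟨e, he, hc, hn, hs e he⟩
  · rw [hd.minner_eq, curvForm, Finset.mul_sum]
    exact Finset.sum_congr rfl fun k _ => hZ' _ (hd.ker k)

theorem sigmaTheta_eq [Nonempty κ] (hd : IsSubgradDecomp P W R x) {H : Matrix ι κ ℝ}
    (hH : H ∈ kerCone P W) : sigmaTheta P H W = ((-2 * curvForm R x H : ℝ) : EReal) := by
  refine le_antisymm (iSup_le fun Z => ?_) ?_
  · obtain ⟨ν, hν⟩ := hd.exists_isSecMax hH Z
    rw [hd.dirDeriv2_eq hH hν, EReal.coe_le_coe_iff]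
    have h := Finset.sum_le_sum fun k (_ : k ∈ Finset.univ) =>
      hν.le (x k) (hd.ker k) (hd.inner_dilation_eq hH k)
    simp only [secForm, Finset.sum_add_distrib, ← Finset.mul_sum, hd.sum_sq, ← hd.minner_eq] at h
    unfold curvForm
    linarith
  · obtain ⟨Z, hZ, hWZ⟩ := hd.exists_isSecMax_zero hH
    refine le_iSup_of_le Z ?_
    rw [hd.dirDeriv2_eq hH hZ, hWZ, sub_zero]

end IsSubgradDecomp

theorem exists_prox_minimizer [Nonempty κ] (Z : Matrix ι κ ℝ) :
    ∃ Y, ∀ X, specNorm Y + (1 / 2) * fnorm (Y - Z) ^ 2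
      ≤ specNorm X + (1 / 2) * fnorm (X - Z) ^ 2 := by
  simp only [fnorm_sq]
  have hZ : minner (Z - Z) (Z - Z) = 0 := by simp [minner]
  obtain ⟨Y, -, hY⟩ := (isCompact_minner_le Z (2 * specNorm Z)).exists_isMinOn
    (f := fun Y => specNorm Y + (1 / 2) * minner (Y - Z) (Y - Z))
    ⟨Z, by
      rw [mem_ofPred_eq, hZ]
      linarith [specNorm_nonneg Z]⟩
    (continuous_specNorm.add (continuous_const.mul (continuous_minner
      (continuous_id.sub continuous_const) (continuous_id.sub continuous_const)))).continuousOn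
  refine ⟨Y, fun X => ?_⟩
  by_cases hX : minner (X - Z) (X - Z) ≤ 2 * specNorm Z
  · exact hY hX
  · have h1 : specNorm Y + (1 / 2) * minner (Y - Z) (Y - Z)
        ≤ specNorm Z + (1 / 2) * minner (Z - Z) (Z - Z) :=
      hY (by
      rw [mem_ofPred_eq, hZ]
      linarith [specNorm_nonneg Z])
    linarith [specNorm_nonneg X]

theorem prox_specNorm_le [Nonempty κ] (Z X : Matrix ι κ ℝ) :
    specNorm (prox specNorm Z) + (1 / 2) * minner (prox specNorm Z - Z) (prox specNorm Z - Z)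
      ≤ specNorm X + (1 / 2) * minner (X - Z) (X - Z) := by
  simp only [← fnorm_sq]
  exact Classical.epsilon_spec (exists_prox_minimizer Z) X

theorem prox_add_eq_of_mem_subdiff [Nonempty κ] {P W : Matrix ι κ ℝ}
    (hW : W ∈ subdiff specNorm P) : prox specNorm (P + W) = P := by
  have h1 := prox_specNorm_le (P + W) P
  set Y := prox specNorm (P + W)
  have h2 := hW Y
  have h3 := minner_add_smul_sub_self P W 0 (Y - P) 1
  have h4 := minner_add_smul_sub_self P W 0 0 1
  have h0 : ∀ A : Matrix ι κ ℝ, minner A 0 = 0 := fun A => by simp [minner]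
  simp only [one_smul, add_sub_cancel, add_zero, sub_zero, h0] at h3 h4
  exact sub_eq_zero.1 (eq_zero_of_minner_self_nonpos (by linarith))

/-- The difference quotient of the proximal mapping solves a rescaled proximal problem. -/
theorem prox_quotient_le [Nonempty κ] (P W E h : Matrix ι κ ℝ) {t : ℝ} (ht : 0 < t)
    {Q : Matrix ι κ ℝ} (hQ : Q = t⁻¹ • (prox specNorm (P + W + t • E) - P)) :
    specNorm (P + t • Q) - t * minner W Q + t ^ 2 / 2 * minner (Q - E) (Q - E)
      ≤ specNorm (P + t • h) - t * minner W h + t ^ 2 / 2 * minner (h - E) (h - E) := by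
  have h1 := prox_specNorm_le (P + W + t • E) (P + t • h)
  have h2 : prox specNorm (P + W + t • E) = P + t • Q := by
    rw [hQ, smul_inv_smul₀ ht.ne', add_sub_cancel]
  rw [h2, minner_add_smul_sub_self, minner_add_smul_sub_self] at h1
  linarith

theorem isClosed_kerCone (P W : Matrix ι κ ℝ) : IsClosed (kerCone P W) := by
  simp only [kerCone, ofPred_forall]
  refine isClosed_iInter fun e => isClosed_iInter fun _ => isClosed_le
    (continuous_const.inner (continuous_dilation_apply e))
    ((continuous_minner continuous_const continuous_id).mul continuous_const)

theorem zero_mem_kerCone (P W : Matrix ι κ ℝ) : 0 ∈ kerCone P W := fun e _ => by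
  simp [minner]

theorem smul_mem_kerCone {P W H : Matrix ι κ ℝ} (hH : H ∈ kerCone P W) {s : ℝ} (hs : 0 ≤ s) :
    s • H ∈ kerCone P W := fun e he => by
  rw [inner_dilation_smul, minner_smul_right, mul_assoc]
  exact mul_le_mul_of_nonneg_left (hH e he) hs

theorem add_mem_kerCone {P W G H : Matrix ι κ ℝ} (hG : G ∈ kerCone P W) (hH : H ∈ kerCone P W) :
    G + H ∈ kerCone P W := fun e he => by
  rw [inner_dilation_add, minner_add_right, add_mul]
  exact add_le_add (hG e he) (hH e he)

theorem curvForm_add_add_curvForm_sub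
    (R : EuclideanSpace ℝ (ι ⊕ κ) →L[ℝ] EuclideanSpace ℝ (ι ⊕ κ))
    (x : ι ⊕ κ → EuclideanSpace ℝ (ι ⊕ κ)) (g h : Matrix ι κ ℝ) :
    curvForm R x (g + h) + curvForm R x (g - h) = 2 * curvForm R x g + 2 * curvForm R x h := by
  simp only [curvForm, Finset.mul_sum, ← Finset.sum_add_distrib]
  refine Finset.sum_congr rfl fun k _ => ?_
  rw [map_add dilation, map_sub dilation, _root_.add_apply, _root_.sub_apply]
  simp only [map_add, map_sub, inner_add_left, inner_add_right, inner_sub_left, inner_sub_right]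
  ring

/-- The objective of the quadratic program solved by the directional derivative of the proximal
mapping in direction `E`. -/
noncomputable def proxObj (R : EuclideanSpace ℝ (ι ⊕ κ) →L[ℝ] EuclideanSpace ℝ (ι ⊕ κ))
    (x : ι ⊕ κ → EuclideanSpace ℝ (ι ⊕ κ)) (E h : Matrix ι κ ℝ) : ℝ :=
  curvForm R x h + (1 / 2) * minner (h - E) (h - E)

theorem continuous_proxObj (R : EuclideanSpace ℝ (ι ⊕ κ) →L[ℝ] EuclideanSpace ℝ (ι ⊕ κ))
    (x : ι ⊕ κ → EuclideanSpace ℝ (ι ⊕ κ)) (E : Matrix ι κ ℝ) : Continuous (proxObj R x E) :=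
  (continuous_curvForm R x).add (continuous_const.mul (continuous_minner
    (continuous_id.sub continuous_const) (continuous_id.sub continuous_const)))

namespace IsSubgradDecomp

variable {P W : Matrix ι κ ℝ} {R : EuclideanSpace ℝ (ι ⊕ κ) →L[ℝ] EuclideanSpace ℝ (ι ⊕ κ)}
  {x : ι ⊕ κ → EuclideanSpace ℝ (ι ⊕ κ)}

theorem exists_isMinOn_proxObj (hd : IsSubgradDecomp P W R x) (E : Matrix ι κ ℝ) :
    ∃ H ∈ kerCone P W, IsMinOn (proxObj R x E) (kerCone P W) H := by
  have h0 : proxObj R x E 0 = (1 / 2) * minner E E := by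
    have h1 := curvForm_smul R x 0 0
    simp only [smul_zero, ne_eq, OfNat.ofNat_ne_zero, not_false_eq_true, zero_pow, zero_mul] at h1
    rw [proxObj, h1, minner_sub_left, minner_sub_right, minner_sub_right]
    simp [minner]
  have hmem : (0 : Matrix ι κ ℝ) ∈ {h | minner (h - E) (h - E) ≤ minner E E} ∩ kerCone P W := by
    refine ⟨?_, zero_mem_kerCone P W⟩
    simp [minner]
  obtain ⟨H, hH, hmin⟩ := ((isCompact_minner_le E (minner E E)).inter_right
    (isClosed_kerCone P W)).exists_isMinOn ⟨0, hmem⟩ (continuous_proxObj R x E).continuousOn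
  refine ⟨H, hH.2, fun G hG => ?_⟩
  by_cases hGE : minner (G - E) (G - E) ≤ minner E E
  · exact hmin ⟨hGE, hG⟩
  · have h1 : proxObj R x E H ≤ proxObj R x E 0 := hmin hmem
    have h2 := hd.curvForm_nonneg G
    change proxObj R x E H ≤ proxObj R x E G
    rw [h0] at h1
    refine h1.trans ?_
    unfold proxObj
    linarith

theorem eq_of_isMinOn_proxObj (hd : IsSubgradDecomp P W R x) {E G H : Matrix ι κ ℝ}
    (hH : H ∈ kerCone P W) (hmin : IsMinOn (proxObj R x E) (kerCone P W) H)
    (hG : G ∈ kerCone P W) (hle : proxObj R x E G ≤ proxObj R x E H) : G = H := by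
  have h1 : proxObj R x E H ≤ proxObj R x E ((1 / 2 : ℝ) • (G + H)) :=
    hmin (smul_mem_kerCone (add_mem_kerCone hG hH) (by norm_num))
  have h2 := curvForm_add_add_curvForm_sub R x G H
  have h3 := hd.curvForm_nonneg (G - H)
  simp only [proxObj, curvForm_smul, minner_sub_left, minner_sub_right, minner_smul_left,
    minner_smul_right, minner_add_left, minner_add_right, minner_comm E, minner_comm H G]
    at h1 hle
  refine sub_eq_zero.1 (eq_zero_of_minner_self_nonpos ?_)
  simp only [minner_sub_left, minner_sub_right, minner_comm H G]
  linarith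

theorem minner_eq_of_isMinOn_proxObj (hd : IsSubgradDecomp P W R x) {D H : Matrix ι κ ℝ}
    (hH : H ∈ kerCone P W) (hmin : IsMinOn (proxObj R x (H + D)) (kerCone P W) H) :
    minner H D = 2 * curvForm R x H := by
  have key : ∀ s : ℝ, 0 ≤ s →
      0 ≤ (s - 1) * ((s - 1) * (curvForm R x H + minner H H / 2)
        + (2 * curvForm R x H - minner H D)) := by
    intro s hs
    have h1 : proxObj R x (H + D) H ≤ proxObj R x (H + D) (s • H) := hmin (smul_mem_kerCone hH hs)
    simp only [proxObj, curvForm_smul, minner_sub_left, minner_sub_right, minner_smul_left,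
      minner_smul_right, minner_add_left, minner_add_right, minner_comm D H] at h1
    linarith
  set A := curvForm R x H + minner H H / 2
  set B := 2 * curvForm R x H - minner H D with hB
  have hA : 0 ≤ A := add_nonneg (hd.curvForm_nonneg H) (by linarith [minner_self_nonneg H])
  set c := A + 1 + |B|
  have hc : 0 < c := by positivity
  have hBc : B = B / c * c := (div_mul_cancel₀ _ hc.ne').symm
  have hτ : B / c ≤ 1 := (div_le_one hc).2 (by linarith [le_abs_self B])
  have h1 := key (1 - B / c) (by linarith)
  have hcA : 1 ≤ c - A := by
    have : c - A = 1 + |B| := by ring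
    linarith [abs_nonneg B]
  have h2 : (B / c) ^ 2 * (c - A) ≤ 0 := by
    have : (1 - B / c - 1) * ((1 - B / c - 1) * A + B / c * c) = -((B / c) ^ 2 * (c - A)) := by
      ring
    rw [← hBc] at this
    linarith
  have h3 : (B / c) ^ 2 = 0 := by nlinarith [sq_nonneg (B / c)]
  rw [pow_eq_zero_iff two_ne_zero] at h3
  rw [h3, zero_mul] at hBc
  linarith

end IsSubgradDecomp

namespace IsSubgradDecomp

variable {P W : Matrix ι κ ℝ} {R : EuclideanSpace ℝ (ι ⊕ κ) →L[ℝ] EuclideanSpace ℝ (ι ⊕ κ)}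
  {x : ι ⊕ κ → EuclideanSpace ℝ (ι ⊕ κ)}

theorem tendsto_prox_quotient [Nonempty κ] (hd : IsSubgradDecomp P W R x)
    (hW : W ∈ subdiff specNorm P) {E H : Matrix ι κ ℝ} (hH : H ∈ kerCone P W)
    (hmin : IsMinOn (proxObj R x E) (kerCone P W) H) :
    Tendsto (fun t : ℝ => t⁻¹ • (prox specNorm (P + W + t • E) - P)) (nhdsWithin 0 (Ioi 0))
      (nhds H) := by
  set Q : ℝ → Matrix ι κ ℝ := fun t => t⁻¹ • (prox specNorm (P + W + t • E) - P)
  have hsub : ∀ (t : ℝ) (h : Matrix ι κ ℝ),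
      specNorm P + t * minner W h ≤ specNorm (P + t • h) := by
    intro t h
    have h1 := hW (P + t • h)
    rwa [add_sub_cancel_left, minner_smul_right] at h1
  have hzero : ∀ t : ℝ, 0 < t → specNorm (P + t • Q t) - t * minner W (Q t)
      + t ^ 2 / 2 * minner (Q t - E) (Q t - E) ≤ specNorm P + t ^ 2 / 2 * minner E E := by
    intro t ht
    have h1 := prox_quotient_le P W E 0 ht (Q := Q t) rfl
    have h2 : minner (0 - E) (0 - E) = minner E E := by simp [minner]
    have h3 : minner W 0 = 0 := by simp [minner]
    rwa [smul_zero, add_zero, h2, h3, mul_zero, sub_zero] at h1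
  have hball : ∀ t : ℝ, 0 < t → minner (Q t - E) (Q t - E) ≤ minner E E := by
    intro t ht
    have h3 : t ^ 2 / 2 * minner (Q t - E) (Q t - E) ≤ t ^ 2 / 2 * minner E E := by
      linarith [hzero t ht, hsub t (Q t)]
    exact le_of_mul_le_mul_left h3 (by positivity)
  obtain ⟨Z, hZ, hWZ⟩ := hd.exists_isSecMax_zero hH
  have hquot := hd.tendsto_secondOrder hH hZ
  rw [tendsto_iff_ultrafilter]
  intro g hg
  have hgpos : ∀ᶠ t in (g : Filter ℝ), 0 < t := hg self_mem_nhdsWithin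
  have hg0 : Tendsto (fun t : ℝ => t) g (nhds 0) := hg.trans nhdsWithin_le_nhds
  obtain ⟨G, -, hG⟩ := (isCompact_minner_le E (minner E E)).ultrafilter_le_nhds (g.map Q)
    (le_principal_iff.2 (hgpos.mono hball))
  replace hG : Tendsto Q g (nhds G) := hG
  have hGW : Tendsto (fun t => minner W (Q t)) g (nhds (minner W G)) :=
    ((continuous_minner continuous_const continuous_id).tendsto G).comp hG
  have hGcone : G ∈ kerCone P W := by
    intro e he
    have h1 : Tendsto (fun t => ⟪e, dilation (Q t) e⟫) g (nhds ⟪e, dilation G e⟫) :=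
      ((continuous_const.inner (continuous_dilation_apply e)).tendsto G).comp hG
    have h2 : Tendsto (fun t => (minner W (Q t) + t * (minner E E / 2)) * ‖e‖ ^ 2) g
        (nhds ((minner W G + 0 * (minner E E / 2)) * ‖e‖ ^ 2)) :=
      (hGW.add (hg0.mul_const _)).mul_const _
    rw [zero_mul, add_zero] at h2
    refine le_of_tendsto_of_tendsto h1 h2 (hgpos.mono fun t ht => ?_)
    have h3 := inner_dilation_le (P + t • Q t) e
    have h4 := inner_normGap_self P e
    rw [he, inner_zero_right] at h4
    rw [inner_dilation_add, inner_dilation_smul] at h3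
    have h5 : specNorm (P + t • Q t)
        ≤ specNorm P + t * (minner W (Q t) + t * (minner E E / 2)) := by
      have h6 := hzero t ht
      have h7 : 0 ≤ t ^ 2 / 2 * minner (Q t - E) (Q t - E) :=
        mul_nonneg (by positivity) (minner_self_nonneg _)
      linarith
    have h8 := h3.trans (mul_le_mul_of_nonneg_right h5 (sq_nonneg ‖e‖))
    exact le_of_mul_le_mul_left (by linarith) ht
  have hobj : proxObj R x E G ≤ proxObj R x E H := by
    set b := ‖dilation G‖ + 1
    have hb : ∀ᶠ t in (g : Filter ℝ), ‖dilation (Q t)‖ ≤ b :=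
      ((((continuous_norm.comp continuous_dilation).tendsto G).comp hG).eventually
        (gt_mem_nhds (lt_add_one _))).mono fun t ht => le_of_lt ht
    have h1 : Tendsto (fun t => proxObj R x E (Q t) - t * (2 * ‖R‖ ^ 2 * b ^ 3)) g
        (nhds (proxObj R x E G - 0 * (2 * ‖R‖ ^ 2 * b ^ 3))) :=
      (((continuous_proxObj R x E).tendsto G).comp hG).sub (hg0.mul_const _)
    set F : ℝ → ℝ := fun t =>
      (1 / 2) * minner (H + (t / 2) • Z - E) (H + (t / 2) • Z - E) with hF
    have hFc : Tendsto F g (nhds ((1 / 2) * minner (H - E) (H - E))) := by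
      have hc : Continuous F := continuous_const.mul
        (continuous_minner (by fun_prop) (by fun_prop))
      have h0 : F 0 = (1 / 2) * minner (H - E) (H - E) := by simp [hF]
      exact h0 ▸ (hc.tendsto 0).comp hg0
    have h2 := (((hquot.mono_left hg).const_mul (1 / 2)).add_const (curvForm R x H)).add hFc
    rw [zero_mul, sub_zero] at h1
    rw [mul_zero, zero_add] at h2
    refine le_of_tendsto_of_tendsto h1 h2 ?_
    filter_upwards [hgpos, hb] with t ht hbt
    have h3 := hd.le_specNorm_add_smul hbt ht
    have h4 := prox_quotient_le P W E (H + (t / 2) • Z) ht (Q := Q t) rfl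
    have h5 : P + t • (H + (t / 2) • Z) = P + t • H + (t ^ 2 / 2) • Z := by
      rw [smul_add, smul_smul, ← add_assoc]
      congr 2
      ring
    rw [h5, minner_add_right W H, minner_smul_right (t / 2) W Z, hWZ] at h4
    set q := (specNorm (P + t • H + (t ^ 2 / 2) • Z) - specNorm P - t * minner W H)
      / (t ^ 2 / 2) with hq
    have h6 : specNorm (P + t • H + (t ^ 2 / 2) • Z)
        = specNorm P + t * minner W H + q * (t ^ 2 / 2) := by
      rw [hq, div_mul_cancel₀ _ (by positivity)]
      ring
    rw [h6] at h4
    refine le_of_mul_le_mul_left ?_ (pow_pos ht 2)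
    simp only [proxObj, hF]
    linarith
  rwa [hd.eq_of_isMinOn_proxObj hH hmin hGcone hobj] at hG

theorem proxDeriv_eq [Nonempty κ] (hd : IsSubgradDecomp P W R x)
    (hW : W ∈ subdiff specNorm P) {E H : Matrix ι κ ℝ} (hH : H ∈ kerCone P W)
    (hmin : IsMinOn (proxObj R x E) (kerCone P W) H) :
    proxDeriv specNorm (P + W) E = H := by
  unfold proxDeriv
  rw [prox_add_eq_of_mem_subdiff hW]
  exact (hd.tendsto_prox_quotient hW hH hmin).limUnder_eq

end IsSubgradDecomp

end SecondOrder

/-- Proposition 3.4: if `H = Prox'_θ(Q; H + D)` with `Q = P + W`,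
then `H ∈ C_θ(P,W)` and `⟨H, D⟩ = −ψ*_{(P,H)}(W)`. -/
theorem proxDeriv_fixed_point_critTheta {m n : ℕ} (hmn : m ≤ n)
    (P W : Matrix (Fin m) (Fin n) ℝ) (hP : P ≠ 0)
    (hW : W ∈ subdiff specNorm P)
    (D H : Matrix (Fin m) (Fin n) ℝ)
    (hfix : H = proxDeriv specNorm (P + W) (H + D)) :
    H ∈ critTheta P W ∧ ((minner H D : ℝ) : EReal) = - sigmaTheta P H W := by
  have hne : Nonempty (Fin n) := by
    by_contra h
    rw [not_nonempty_iff] at h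
    exact hP (Matrix.ext fun _ j => h.elim j)
  obtain ⟨R, x, hd⟩ := exists_isSubgradDecomp hP hW
  obtain ⟨G, hG, hmin⟩ := hd.exists_isMinOn_proxObj (H + D)
  obtain rfl : H = G := hfix.trans (hd.proxDeriv_eq hW hG hmin)
  refine ⟨hd.mem_critTheta hG, ?_⟩
  rw [hd.sigmaTheta_eq hG, hd.minner_eq_of_isMinOn_proxObj hG hmin, ← EReal.coe_neg]
  congr 1
  ring
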